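/- arXiv:0804.2776 — 4 statements merged into one kernel-verified Lean document; each statement's English description precedes it below -/
import Mathlib

section
/- Let T be a tree that maximizes the largest Laplacian eigenvalue among all trees with its degree sequence, and let f be an eigenvector of L(T) corresponding to λ(T). Then for all vertices u, v of T, |f(v)| > |f(u)| implies deg(v) ≥ deg(u). -/
open SimpleGraph Finset Matrix

/-- The degree of vertex `v`: the number of its neighbors. -/
noncomputable def gdeg {V : Type*} (G : SimpleGraph V) (v : V) : ℕ :=
  (G.neighborSet v).ncard

open scoped Classical in
/-- The Laplacian matrix `L = D - A` of a graph, with real entries. -/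
noncomputable def lap {V : Type*} [Fintype V] [DecidableEq V] (G : SimpleGraph V) :
    Matrix V V ℝ :=
  Matrix.of fun u v =>
    (if u = v then (gdeg G u : ℝ) else 0) - (if G.Adj u v then 1 else 0)

/-- `lam` is the largest Laplacian eigenvalue of `G`. -/
def IsMaxEig {V : Type*} [Fintype V] [DecidableEq V] (G : SimpleGraph V) (lam : ℝ) : Prop :=
  IsGreatest {μ : ℝ | ∃ f : V → ℝ, f ≠ 0 ∧ (lap G).mulVec f = μ • f} lam

open scoped Classical in
lemma gdeg_eq {V : Type*} [Fintype V] (G : SimpleGraph V) (v : V) :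
    gdeg G v = G.degree v := by
  unfold gdeg
  rw [← G.card_neighborFinset_eq_degree, ← Set.ncard_coe_finset, coe_neighborFinset]

open scoped Classical in
lemma lap_eq {V : Type*} [Fintype V] [DecidableEq V] (G : SimpleGraph V) :
    lap G = G.lapMatrix ℝ := by
  ext i j
  simp [lap, lapMatrix, degMatrix, Matrix.diagonal_apply, gdeg_eq, adjMatrix_apply]

open scoped Classical in
lemma quad_eq {V : Type*} [Fintype V] [DecidableEq V] (G : SimpleGraph V) (f : V → ℝ) :
    f ⬝ᵥ ((lap G).mulVec f) =
      (∑ i, ∑ j, (if G.Adj i j then 1 else 0) * (f i - f j) ^ 2) / 2 := by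
  rw [lap_eq, ← Matrix.toLinearMap₂'_apply', lapMatrix_toLinearMap₂']
  simp

lemma lap_herm {V : Type*} [Fintype V] [DecidableEq V] (G : SimpleGraph V) :
    (lap G).IsHermitian := by
  classical
  rw [lap_eq]; exact G.isHermitian_lapMatrix ℝ

lemma exists_max {V : Type*} [Fintype V] [DecidableEq V] [Nonempty V] (G : SimpleGraph V) :
    ∃ lam, IsMaxEig G lam ∧ ∀ h : V → ℝ, h ⬝ᵥ ((lap G).mulVec h) ≤ lam * (h ⬝ᵥ h) := by
  classical
  have hA := lap_herm G
  set S : Set ℝ := {μ : ℝ | ∃ f : V → ℝ, f ≠ 0 ∧ (lap G).mulVec f = μ • f} with hS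
  have hfin : S.Finite := by
    refine (Module.End.finite_hasEigenvalue (Matrix.toLin' (lap G))).subset ?_
    rintro μ ⟨f, hf, h⟩
    exact Module.End.hasEigenvalue_of_hasEigenvector (x := f)
      ⟨Module.End.mem_eigenspace_iff.2 (by simpa using h), hf⟩
  have key : ∀ {A : Matrix V V ℝ} (hA : A.IsHermitian) (i : V),
      ∃ f : V → ℝ, f ≠ 0 ∧ A.mulVec f = hA.eigenvalues i • f := by
    intro A hA i
    refine ⟨hA.eigenvectorBasis i, ?_, hA.mulVec_eigenvectorBasis i⟩
    intro h
    apply hA.eigenvectorBasis.toBasis.ne_zero i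
    ext j
    simpa using congrFun h j
  have hne : S.Nonempty := ⟨_, key hA (Classical.arbitrary V)⟩
  obtain ⟨M, hM, hmax⟩ := Set.exists_max_image S id hfin hne
  refine ⟨M, ⟨hM, fun x hx => hmax x hx⟩, fun h => ?_⟩
  have hB : (M • (1 : Matrix V V ℝ) - lap G).IsHermitian := by
    refine IsHermitian.sub ?_ hA
    simp [IsHermitian]
  have hP : (M • (1 : Matrix V V ℝ) - lap G).PosSemidef := by
    rw [hB.posSemidef_iff_eigenvalues_nonneg]
    intro i
    obtain ⟨f, hf, h⟩ := key hB i
    have : M - hB.eigenvalues i ∈ S := by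
      refine ⟨f, hf, ?_⟩
      rw [sub_smul, ← h, sub_mulVec, smul_mulVec, one_mulVec]
      abel
    have := hmax _ this
    simp at this
    simpa using this
  have := hP.dotProduct_mulVec_nonneg h
  rw [sub_mulVec, smul_mulVec, one_mulVec, dotProduct_sub, dotProduct_smul] at this
  simpa using this

/-- Move the neighbours in `S` from `u` to `w`. -/
def mv {V : Type*} (T : SimpleGraph V) (u w : V) (S : Finset V) (hw : w ∉ S) : SimpleGraph V where
  Adj i j := (T.Adj i j ∧ ¬(i = u ∧ j ∈ S) ∧ ¬(j = u ∧ i ∈ S)) ∨ (i = w ∧ j ∈ S) ∨ (j = w ∧ i ∈ S)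
  symm := ⟨fun i j h => by
    rcases h with ⟨h1, h2, h3⟩ | h | h
    · exact Or.inl ⟨h1.symm, h3, h2⟩
    · exact Or.inr (Or.inr h)
    · exact Or.inr (Or.inl h)⟩
  loopless := ⟨fun i h => by
    rcases h with ⟨h1, h2, h3⟩ | ⟨rfl, h⟩ | ⟨rfl, h⟩
    · exact h1.ne rfl
    · exact hw h
    · exact hw h⟩

open scoped Classical in
lemma mv_ind {V : Type*} [DecidableEq V] (T : SimpleGraph V) (u w : V) (S : Finset V) (hw : w ∉ S)
    (huw : u ≠ w) (hu : ∀ x ∈ S, T.Adj u x) (hwx : ∀ x ∈ S, ¬ T.Adj w x) (i j : V) :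
    (if (mv T u w S hw).Adj i j then (1 : ℝ) else 0) =
      (if T.Adj i j then 1 else 0)
      + ((if i = w then 1 else 0) - (if i = u then 1 else 0)) * (if j ∈ S then 1 else 0)
      + ((if j = w then 1 else 0) - (if j = u then 1 else 0)) * (if i ∈ S then 1 else 0) := by
  have huS : u ∉ S := fun h => (hu u h).ne rfl
  have h1 := hu i
  have h2 := hu j
  have h3 := hwx i
  have h4 := hwx j
  have h5 := T.adj_comm i j
  simp only [mv]
  by_cases a : i = u <;> by_cases b : j = u <;> by_cases c : i = w <;> by_cases d : j = w <;>
    by_cases e : i ∈ S <;> by_cases f : j ∈ S <;> simp_all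

lemma sum_ind {V : Type*} [Fintype V] [DecidableEq V] (S : Finset V) (u w : V) (F : V → V → ℝ)
    (hF : ∀ i j, F i j = F j i) (A : V → V → ℝ) :
    ∑ i, ∑ j, (A i j
      + ((if i = w then 1 else 0) - (if i = u then 1 else 0)) * (if j ∈ S then 1 else 0)
      + ((if j = w then 1 else 0) - (if j = u then 1 else 0)) * (if i ∈ S then 1 else 0)) * F i j
    = ∑ i, ∑ j, A i j * F i j + 2 * ∑ x ∈ S, (F w x - F u x) := by
  have e1 : ∑ i, ∑ j, (((if i = w then 1 else 0) - (if i = u then 1 else 0)) *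
      (if j ∈ S then 1 else 0)) * F i j = ∑ x ∈ S, (F w x - F u x) := by
    rw [Finset.sum_comm]
    rw [← Finset.sum_filter_add_sum_filter_not univ (· ∈ S)]
    rw [Finset.sum_eq_zero (s := univ.filter (· ∉ S))]
    · rw [add_zero]
      refine Finset.sum_congr (by ext; simp) fun x hx => ?_
      simp [hx, sub_mul, Finset.sum_sub_distrib]
    · intro x hx
      simp at hx
      simp [hx]
  have e2 : ∑ i, ∑ j, (((if j = w then 1 else 0) - (if j = u then 1 else 0)) *
      (if i ∈ S then 1 else 0)) * F i j = ∑ x ∈ S, (F w x - F u x) := by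
    rw [← e1, Finset.sum_comm]
    refine Finset.sum_congr rfl fun i _ => Finset.sum_congr rfl fun j _ => ?_
    rw [hF]
  simp only [add_mul, Finset.sum_add_distrib, e1, e2]
  ring

open scoped Classical in
lemma gdeg_sum {V : Type*} [Fintype V] (G : SimpleGraph V) (v : V) :
    (gdeg G v : ℝ) = ∑ j, if G.Adj v j then 1 else 0 := by
  rw [gdeg_eq, degree_eq_sum_if_adj]

lemma mv_gdeg {V : Type*} [Fintype V] [DecidableEq V] (T : SimpleGraph V) (u w : V) (S : Finset V)
    (hw : w ∉ S)
    (huw : u ≠ w) (hu : ∀ x ∈ S, T.Adj u x) (hwx : ∀ x ∈ S, ¬ T.Adj w x) (i : V) :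
    (gdeg (mv T u w S hw) i : ℝ) =
      gdeg T i + ((if i = w then 1 else 0) - (if i = u then 1 else 0)) * #S := by
  classical
  rw [gdeg_sum, gdeg_sum]
  simp_rw [mv_ind T u w S hw huw hu hwx]
  simp only [Finset.sum_add_distrib, ← Finset.mul_sum, ← Finset.sum_mul, Finset.sum_sub_distrib]
  simp

lemma mv_tree {V : Type*} [Fintype V] [DecidableEq V] (T : SimpleGraph V) (hT : T.IsTree)
    (u w : V) (S : Finset V) (hw : w ∉ S)
    (huw : u ≠ w) (hu : ∀ x ∈ S, T.Adj u x) (hwx : ∀ x ∈ S, ¬ T.Adj w x)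
    (p : T.Walk u w) (hp : ∀ x ∈ S, x ∉ p.support) : (mv T u w S hw).IsTree := by
  classical
  rw [isTree_iff_connected_and_card] at hT ⊢
  obtain ⟨hc, hcard⟩ := hT
  constructor
  · have hreach : (mv T u w S hw).Reachable u w := by
      refine ⟨p.transfer _ ?_⟩
      intro e he
      induction e with | _ a b =>
      have ha := p.fst_mem_support_of_mem_edges he
      have hb := p.snd_mem_support_of_mem_edges he
      exact Or.inl ⟨p.adj_of_mem_edges he, fun h => hp _ h.2 hb, fun h => hp _ h.2 ha⟩
    have hadj : ∀ a b, T.Adj a b → (mv T u w S hw).Reachable a b := by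
      intro a b hab
      by_cases h1 : a = u ∧ b ∈ S
      · obtain ⟨rfl, h⟩ := h1
        exact hreach.trans (Adj.reachable (Or.inr (Or.inl ⟨rfl, h⟩)))
      by_cases h2 : b = u ∧ a ∈ S
      · obtain ⟨rfl, h⟩ := h2
        exact (hreach.trans (Adj.reachable (Or.inr (Or.inl ⟨rfl, h⟩)))).symm
      exact Adj.reachable (Or.inl ⟨hab, h1, h2⟩)
    have := hc.nonempty
    refine ⟨fun a b => ?_⟩
    obtain ⟨q⟩ := hc.preconnected a b
    induction q with
    | nil => exact Reachable.refl _
    | cons h _ ih => exact (hadj _ _ h).trans ih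
  · rw [← hcard]
    congr 1
    have h1 := T.sum_degrees_eq_twice_card_edges
    have h2 := (mv T u w S hw).sum_degrees_eq_twice_card_edges
    have h3 : ((∑ v, (mv T u w S hw).degree v : ℕ) : ℝ) = ((∑ v, T.degree v : ℕ) : ℝ) := by
      push_cast
      simp_rw [← gdeg_eq, mv_gdeg T u w S hw huw hu hwx]
      simp only [Finset.sum_add_distrib, ← Finset.sum_mul, Finset.sum_sub_distrib]
      simp
    have h4 : (∑ v, (mv T u w S hw).degree v) = ∑ v, T.degree v := by exact_mod_cast h3
    rw [Nat.card_eq_fintype_card, Nat.card_eq_fintype_card, ← edgeFinset_card, ← edgeFinset_card]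
    omega

/-- If `T` maximizes the largest Laplacian eigenvalue among all trees with its
degree sequence, and `f` is an eigenvector for `λ(T)`, then `|f v| > |f u|`
implies `deg v ≥ deg u`. -/
theorem stmt8 {V : Type*} [Fintype V] [DecidableEq V] (T : SimpleGraph V)
    (hT : T.IsTree) (lam : ℝ) (hlam : IsMaxEig T lam)
    (hext : ∀ T'' : SimpleGraph V, T''.IsTree →
      (∃ σ : Equiv.Perm V, ∀ w, gdeg T'' (σ w) = gdeg T w) →
      ∀ lam'', IsMaxEig T'' lam'' → lam'' ≤ lam)
    (f : V → ℝ) (hf : f ≠ 0) (hef : (lap T).mulVec f = lam • f) :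
    ∀ u w : V, |f u| < |f w| → gdeg T u ≤ gdeg T w := by

  classical
  intro u w hlt
  by_contra! hdeg
  have huw : u ≠ w := by rintro rfl; exact lt_irrefl _ hlt
  have : Nonempty V := ⟨u⟩
  have : Nontrivial V := ⟨u, w, huw⟩
  obtain ⟨p, hp⟩ := hT.connected.exists_isPath u w
  have hwpos : 0 < gdeg T w := by
    rw [gdeg_eq]; exact hT.connected.preconnected.degree_pos_of_nontrivial w
  obtain ⟨S, hSsub, hScard⟩ : ∃ S ⊆ (T.neighborFinset u).erase p.snd,
      #S = gdeg T u - gdeg T w := by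
    apply Finset.exists_subset_card_eq
    have := Finset.pred_card_le_card_erase (s := T.neighborFinset u) (a := p.snd)
    rw [card_neighborFinset_eq_degree, ← gdeg_eq] at this
    omega
  have hu : ∀ x ∈ S, T.Adj u x := fun x hx => by
    have := hSsub hx
    simp at this
    exact this.2
  have hps : ∀ x ∈ S, x ∉ p.support := fun x hx hxs => by
    have h1 := hSsub hx
    have h2 := hT.isAcyclic.eq_snd_of_adj_start hp (hu x hx) hxs
    simp [← h2] at h1
  have hw : w ∉ S := fun h => hps w h p.end_mem_support
  have hwx : ∀ x ∈ S, ¬ T.Adj w x := fun x hx h => by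
    have := hT.isAcyclic.mem_support_of_ne_mem_support_of_adj_of_isPath
      (p := (Path.singleton (hu x hx)).1) (Path.singleton (hu x hx)).2 hp h.symm (hps x hx)
    simp at this
    rcases this with h' | h'
    · exact huw h'.symm
    · exact hw (h' ▸ hx)
  have htree := mv_tree T hT u w S hw huw hu hwx p hps
  have hg := mv_gdeg T u w S hw huw hu hwx
  obtain ⟨lam', hmax, hray⟩ := exists_max (mv T u w S hw)
  have hle : lam' ≤ lam := by
    refine hext _ htree ⟨Equiv.swap u w, fun x => ?_⟩ lam' hmax
    have hS : (#S : ℝ) = gdeg T u - gdeg T w := by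
      rw [hScard, Nat.cast_sub hdeg.le]
    have : (gdeg (mv T u w S hw) (Equiv.swap u w x) : ℝ) = gdeg T x := by
      rw [hg, hS]
      by_cases h1 : x = u
      · subst h1; simp [huw.symm]
      by_cases h2 : x = w
      · subst h2; simp [huw]
      rw [Equiv.swap_apply_of_ne_of_ne h1 h2]
      simp [h1, h2]
    exact_mod_cast this
  obtain ⟨c⟩ := htree.colorable_two
  let h : V → ℝ := fun x => (if c x = 0 then 1 else -1) * |f x|
  have hhh : h ⬝ᵥ h = f ⬝ᵥ f := by
    refine Finset.sum_congr rfl fun x _ => ?_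
    simp only [h]
    split_ifs <;> simp
  have hff : 0 ≤ f ⬝ᵥ f := Finset.sum_nonneg fun x _ => mul_self_nonneg _
  have q1 : h ⬝ᵥ ((lap (mv T u w S hw)).mulVec h) =
      (∑ i, ∑ j, (if (mv T u w S hw).Adj i j then 1 else 0) * (|f i| + |f j|) ^ 2) / 2 := by
    rw [quad_eq]
    congr 1
    refine Finset.sum_congr rfl fun i _ => Finset.sum_congr rfl fun j _ => ?_
    split_ifs with hij
    · have hne := c.valid hij
      simp only [h]
      by_cases h1 : c i = 0 <;> by_cases h2 : c j = 0
      · exact absurd (h1.trans h2.symm) hne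
      · simp [h1, h2]
      · simp [h1, h2]; ring
      · exact absurd (by omega) hne
    · simp
  have q2 : f ⬝ᵥ ((lap T).mulVec f) ≤
      (∑ i, ∑ j, (if T.Adj i j then 1 else 0) * (|f i| + |f j|) ^ 2) / 2 := by
    rw [quad_eq]
    refine div_le_div_of_nonneg_right (Finset.sum_le_sum fun i _ => Finset.sum_le_sum fun j _ =>
      mul_le_mul_of_nonneg_left ?_ (by split_ifs <;> norm_num)) (by norm_num)
    rw [← sq_abs (f i - f j)]
    exact pow_le_pow_left₀ (abs_nonneg _) (abs_sub _ _) 2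
  have q3 := sum_ind S u w (fun i j => (|f i| + |f j|) ^ 2) (fun i j => by ring)
    (fun i j => if T.Adj i j then 1 else 0)
  simp_rw [mv_ind T u w S hw huw hu hwx] at q1
  rw [q3] at q1
  have q4 : 0 < ∑ x ∈ S, ((|f w| + |f x|) ^ 2 - (|f u| + |f x|) ^ 2) := by
    apply Finset.sum_pos
    · intro x _
      have := abs_nonneg (f x)
      have := abs_nonneg (f u)
      nlinarith
    · rw [← Finset.card_pos]; omega
  have q5 := hray h
  rw [hhh] at q5
  rw [hef, dotProduct_smul, smul_eq_mul] at q2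
  have q6 := mul_le_mul_of_nonneg_right hle hff
  linarith
end

section
/- For every tree degree sequence π there exists a BFD-tree with degree sequence π, and any two BFD-trees with degree sequence π are isomorphic. -/
open SimpleGraph Finset

/-- `lt` is a BFD-ordering of the connected graph `T` with root `v₀`:
a (strict, total, hence well-) ordering of the vertices with least element `v₀` such that
(B1) if `w₁ ≺ w₂` then every child `v₁` of `w₁` precedes every child `v₂` of `w₂`
(children taken w.r.t. the breadth-first layer structure from `v₀`, i.e. `v` is a child
of `w` if `w ~ v` and `dist v₀ v = dist v₀ w + 1`), and
(B2) `v ≺ u` implies `deg v ≥ deg u`. -/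
def IsBFDOrdering {V : Type*} [Fintype V] [DecidableEq V] (T : SimpleGraph V) (v₀ : V)
    (lt : V → V → Prop) : Prop :=
  IsStrictTotalOrder V lt ∧
  (∀ v : V, v ≠ v₀ → lt v₀ v) ∧
  (∀ w₁ w₂ v₁ v₂ : V, lt w₁ w₂ →
      T.Adj w₁ v₁ → T.dist v₀ v₁ = T.dist v₀ w₁ + 1 →
      T.Adj w₂ v₂ → T.dist v₀ v₂ = T.dist v₀ w₂ + 1 →
      lt v₁ v₂) ∧
  (∀ v u : V, lt v u → gdeg T u ≤ gdeg T v)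

/-- A BFD-tree: a tree admitting a BFD-ordering for some root. -/
def IsBFDTree {V : Type*} [Fintype V] [DecidableEq V] (T : SimpleGraph V) : Prop :=
  T.IsTree ∧ ∃ (v₀ : V) (lt : V → V → Prop), IsBFDOrdering T v₀ lt

lemma closer_exists {V : Type*} {T : SimpleGraph V} (hT : T.Connected) (v₀ v : V) (hv : v ≠ v₀) :
    ∃ p, T.Adj p v ∧ T.dist v₀ v = T.dist v₀ p + 1 := by
  obtain ⟨w, hw⟩ := hT.exists_walk_length_eq_dist v v₀
  cases w with
  | nil => exact absurd rfl hv
  | @cons _ p _ h q =>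
    refine ⟨p, h.symm, ?_⟩
    have h1 := dist_le q
    rw [Walk.length_cons] at hw
    have h2 := hT.dist_triangle (u := v) (v := p) (w := v₀)
    have h3 : T.dist v p = 1 := dist_eq_one_iff_adj.2 h
    rw [dist_comm (u := v₀) (v := v), dist_comm (u := v₀) (v := p)]
    omega

lemma closer_unique {V : Type*} {T : SimpleGraph V} (hT : T.IsTree) (v₀ v p q : V)
    (hp : T.Adj p v) (hq : T.Adj q v) (hdp : T.dist v₀ v = T.dist v₀ p + 1)
    (hdq : T.dist v₀ v = T.dist v₀ q + 1) : p = q := by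
  obtain ⟨w, hw⟩ := hT.1.exists_walk_length_eq_dist v₀ p
  obtain ⟨w', hw'⟩ := hT.1.exists_walk_length_eq_dist v₀ q
  have h1 : (w.concat hp).IsPath := Walk.isPath_of_length_eq_dist _ (by simp [hw, hdp])
  have h2 : (w'.concat hq).IsPath := Walk.isPath_of_length_eq_dist _ (by simp [hw', hdq])
  have h3 := (hT.existsUnique_path v₀ v).unique h1 h2
  have := congrArg Walk.penultimate h3
  simpa using this

def Csum {n : ℕ} (d : Fin n → ℕ) (i : ℕ) : ℕ :=
  ∑ j ∈ univ.filter (fun j : Fin n => j.val < i), (d j - if j.val = 0 then 0 else 1)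

lemma key {V : Type*} [Fintype V] [DecidableEq V] (n : ℕ) (hn : 1 ≤ n)
    (hcard : Fintype.card V = n) (T : SimpleGraph V) (h : IsBFDTree T) :
    ∃ (e : V ≃ Fin n) (par : V → V),
      (∀ a b, T.Adj a b ↔ ((e b).val ≠ 0 ∧ par b = a) ∨ ((e a).val ≠ 0 ∧ par a = b)) ∧
      Antitone (fun i => gdeg T (e.symm i)) ∧
      ∀ v, (e v).val ≠ 0 → ∀ i : ℕ,
        ((e (par v)).val < i ↔ (e v).val ≤ Csum (fun i => gdeg T (e.symm i)) i) := by
  classical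
  obtain ⟨hT, v₀, lt, hsto, hroot, hB1, hB2⟩ := h
  obtain ⟨e, he⟩ : ∃ e : V ≃ Fin n, ∀ a b, lt a b ↔ e a < e b := by
    let : LinearOrder V := linearOrderOfSTO lt
    let f := monoEquivOfFin V hcard
    refine ⟨f.symm.toEquiv, fun a b => ?_⟩
    exact (f.symm.lt_iff_lt (x := a) (y := b)).symm
  have he0 : (e v₀).val = 0 := by
    by_contra hc
    have : e.symm ⟨0, hn⟩ ≠ v₀ := by
      rintro h; rw [← h] at hc; simp at hc
    have := (he _ _).1 (hroot _ this)
    simp [Fin.lt_def] at this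
  have hne : ∀ v, (e v).val ≠ 0 ↔ v ≠ v₀ := by
    intro v
    rw [not_iff_not, ← he0, ← Fin.ext_iff, e.apply_eq_iff_eq]
  have hex : ∀ v, ∃ p, v ≠ v₀ → T.Adj p v ∧ T.dist v₀ v = T.dist v₀ p + 1 := by
    intro v
    by_cases hv : v = v₀
    · exact ⟨v, fun h => absurd hv h⟩
    · obtain ⟨p, hp⟩ := closer_exists hT.1 v₀ v hv
      exact ⟨p, fun _ => hp⟩
  choose par hpar using hex
  have hadj : ∀ a b, T.Adj a b ↔ (b ≠ v₀ ∧ par b = a) ∨ (a ≠ v₀ ∧ par a = b) := by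
    intro a b
    constructor
    · intro hab
      rcases hT.dist_eq_dist_add_one_of_adj v₀ hab with h | h
      · right
        have : a ≠ v₀ := by rintro rfl; simp at h
        exact ⟨this, closer_unique hT v₀ a _ _ (hpar a this).1 hab.symm (hpar a this).2 h⟩
      · left
        have : b ≠ v₀ := by rintro rfl; simp at h
        exact ⟨this, closer_unique hT v₀ b _ _ (hpar b this).1 hab (hpar b this).2 h⟩
    · rintro (⟨h, rfl⟩ | ⟨h, rfl⟩)
      · exact (hpar b h).1
      · exact (hpar a h).1.symm
  have hmono : ∀ u v, u ≠ v₀ → v ≠ v₀ → e u ≤ e v → e (par u) ≤ e (par v) := by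
    intro u v hu hv huv
    by_contra! hc
    have := hB1 _ _ v u ((he _ _).2 hc) (hpar v hv).1 (hpar v hv).2 (hpar u hu).1 (hpar u hu).2
    have := (he _ _).1 this
    exact absurd huv (not_le.2 this)
  have hdist : ∀ v, v ≠ v₀ → T.dist v₀ v = T.dist v₀ (par v) + 1 := fun v hv => (hpar v hv).2
  -- degrees
  have hfib : ∀ w, (univ.filter (fun v => v ≠ v₀ ∧ par v = w)).card
      = gdeg T w - if (e w).val = 0 then 0 else 1 := by
    intro w
    have hnot : w ≠ v₀ → par w ∉ univ.filter (fun v => v ≠ v₀ ∧ par v = w) := by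
      intro hw hmem
      simp only [mem_filter, mem_univ, true_and] at hmem
      have h1 := hdist w hw
      have h2 := hdist _ hmem.1
      rw [hmem.2] at h2
      omega
    by_cases hw : w = v₀
    · have : T.neighborSet w = (univ.filter (fun v => v ≠ v₀ ∧ par v = w) : Finset V) := by
        ext x
        simp [hadj, hw]
      rw [gdeg, this, Set.ncard_coe_finset]
      simp [hw, he0]
    · have : T.neighborSet w
          = (insert (par w) (univ.filter (fun v => v ≠ v₀ ∧ par v = w)) : Finset V) := by
        ext x
        simp only [mem_neighborSet, hadj, coe_insert, Set.mem_insert_iff, mem_coe, mem_filter,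
          mem_univ, true_and]
        constructor
        · rintro (h | h)
          · exact Or.inr h
          · exact Or.inl h.2.symm
        · rintro (h | h)
          · exact Or.inr ⟨hw, h.symm⟩
          · exact Or.inl h
      rw [gdeg, this, Set.ncard_coe_finset, card_insert_of_notMem (hnot hw), if_neg ((hne w).2 hw)]
      simp
  have hS : ∀ i : ℕ, (univ.filter (fun v => v ≠ v₀ ∧ (e (par v)).val < i)).card
      = Csum (fun i => gdeg T (e.symm i)) i := by
    intro i
    rw [Csum, card_eq_sum_card_fiberwise (f := fun v => e (par v))
      (t := univ.filter (fun j : Fin n => j.val < i))]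
    · refine sum_congr rfl fun j hj => ?_
      have := hfib (e.symm j)
      rw [Equiv.apply_symm_apply] at this
      rw [← this]
      congr 1
      ext x
      simp only [mem_filter, mem_univ, true_and] at hj ⊢
      rw [Equiv.eq_symm_apply]
      constructor
      · rintro ⟨⟨h1, _⟩, h2⟩; exact ⟨h1, h2⟩
      · rintro ⟨h1, h2⟩; exact ⟨⟨h1, by rw [h2]; exact hj⟩, h2⟩
    · intro x hx
      simpa using (by simpa using hx : _ ∧ _).2
  refine ⟨e, par, ?_, ?_, ?_⟩
  · intro a b; rw [hadj, hne, hne]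
  · intro i j hij
    rcases hij.eq_or_lt with rfl | h
    · exact le_rfl
    · exact hB2 _ _ ((he _ _).2 (by simpa using h))
  · intro v hv i
    have hv' := (hne v).1 hv
    rw [← hS]
    constructor
    · intro hlt
      have : (univ.filter (fun u => u ≠ v₀ ∧ e u ≤ e v)).card = (e v).val := by
        have h1 : univ.filter (fun u => u ≠ v₀ ∧ e u ≤ e v)
            = ((Finset.Ioc (e v₀) (e v)).map e.symm.toEmbedding) := by
          ext x
          simp only [mem_filter, mem_univ, true_and, mem_map_equiv, Equiv.symm_symm, mem_Ioc]
          rw [← hne, Fin.lt_def, he0]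
          omega
        rw [h1, card_map, Fin.card_Ioc, he0]; simp
      rw [← this]
      apply card_le_card
      intro u
      simp only [mem_filter, mem_univ, true_and]
      rintro ⟨h1, h2⟩
      exact ⟨h1, lt_of_le_of_lt (hmono u v h1 hv' h2) hlt⟩
    · intro hle
      by_contra hc
      have : (univ.filter (fun u => u ≠ v₀ ∧ e u < e v)).card = (e v).val - 1 := by
        have h1 : univ.filter (fun u => u ≠ v₀ ∧ e u < e v)
            = ((Finset.Ioo (e v₀) (e v)).map e.symm.toEmbedding) := by
          ext x
          simp only [mem_filter, mem_univ, true_and, mem_map_equiv, Equiv.symm_symm, mem_Ioo]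
          rw [← hne, Fin.lt_def (a := e v₀), he0]
          omega
        rw [h1, card_map, Fin.card_Ioo, he0]; simp
      have h2 : (univ.filter (fun v => v ≠ v₀ ∧ (e (par v)).val < i)).card
          ≤ (univ.filter (fun u => u ≠ v₀ ∧ e u < e v)).card := by
        apply card_le_card
        intro u
        simp only [mem_filter, mem_univ, true_and]
        rintro ⟨h1, h2⟩
        refine ⟨h1, ?_⟩
        by_contra hc2
        have := hmono v u hv' h1 (not_lt.1 hc2)
        rw [Fin.le_def] at this
        omega
      omega

lemma uniq (n : ℕ) (hn : 1 ≤ n) (π : Fin n → ℕ) (T T' : SimpleGraph (Fin n))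
    (hT : IsBFDTree T) (hσ : ∃ σ : Equiv.Perm (Fin n), ∀ i, gdeg T (σ i) = π i)
    (hT' : IsBFDTree T') (hσ' : ∃ σ : Equiv.Perm (Fin n), ∀ i, gdeg T' (σ i) = π i) :
    Nonempty (T ≃g T') := by
  obtain ⟨e, par, hadj, hanti, hC⟩ := key n hn (by simp) T hT
  obtain ⟨e', par', hadj', hanti', hC'⟩ := key n hn (by simp) T' hT'
  obtain ⟨σ, hσ⟩ := hσ
  obtain ⟨σ', hσ'⟩ := hσ'
  have hd : (fun i => gdeg T (e.symm i)) = (fun i => gdeg T' (e'.symm i)) := by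
    have h1 : (fun i => gdeg T (e.symm i)) = π ∘ (e.symm.trans σ.symm) := by
      ext i; simp [← hσ]
    have h2 : (fun i => gdeg T' (e'.symm i)) = π ∘ (e'.symm.trans σ'.symm) := by
      ext i; simp [← hσ']
    rw [h1] at hanti ⊢
    rw [h2] at hanti' ⊢
    exact Tuple.unique_antitone hanti hanti'
  have hp : ∀ v, (e v).val ≠ 0 → par' (e'.symm (e v)) = e'.symm (e (par v)) := by
    intro v hv
    rw [Equiv.eq_symm_apply, Fin.ext_iff]
    have h1 := hC v hv
    have h2 := hC' (e'.symm (e v)) (by simpa using hv)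
    rw [← hd] at h2
    rw [Equiv.apply_symm_apply] at h2
    have h3 := fun i => (h1 i).trans (h2 i).symm
    have a1 := h3 (e (par v)).val
    have a2 := h3 (e' (par' (e'.symm (e v)))).val
    omega
  refine ⟨⟨e.trans e'.symm, ?_⟩⟩
  intro a b
  rw [hadj, hadj']
  simp only [Equiv.trans_apply, Equiv.apply_symm_apply]
  have i1 : ∀ a b, ((e b).val ≠ 0 ∧ par' (e'.symm (e b)) = e'.symm (e a)) ↔
      ((e b).val ≠ 0 ∧ par b = a) := by
    intro a b
    refine and_congr_right fun h => ?_
    rw [hp b h]; simp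
  rw [i1, i1]

lemma exist_nat (n : ℕ) (hn : 2 ≤ n) (d : ℕ → ℕ) (hanti : Antitone d) (hpos : ∀ i, 0 < d i)
    (hsum : ∑ i ∈ range n, d i = 2 * (n - 1)) :
    ∃ C : ℕ → ℕ, Monotone C ∧ C n = n - 1 ∧
      (∀ i, C (i + 1) - C i = d i - if i = 0 then 0 else 1) ∧
      C 0 = 0 ∧ ∀ i, 1 ≤ i → i < n → i ≤ C i := by
  let C : ℕ → ℕ := fun i => ∑ j ∈ range i, (d j - if j = 0 then 0 else 1)
  have hs : ∀ i, C (i + 1) = C i + (d i - if i = 0 then 0 else 1) := fun i => sum_range_succ _ _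
  have hC : ∀ i, C (i + 1) + i = ∑ j ∈ range (i + 1), d j := by
    intro i
    induction i with
    | zero => simp [C]
    | succ k ih =>
      rw [sum_range_succ, ← ih, hs (k + 1)]
      have := hpos (k + 1)
      simp
      omega
  refine ⟨C, monotone_nat_of_le_succ fun i => by rw [hs]; omega, ?_, ?_, by simp [C], ?_⟩
  · have := hC (n - 1)
    rw [Nat.sub_add_cancel (by omega)] at this
    omega
  · intro i; rw [hs]; omega
  · intro i hi hin
    obtain ⟨k, rfl⟩ : ∃ k, i = k + 1 := ⟨i - 1, by omega⟩
    have h1 := hC k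
    by_cases h2 : 2 ≤ d k
    · have : (range (k + 1)).card • 2 ≤ ∑ j ∈ range (k + 1), d j := by
        apply card_nsmul_le_sum
        intro x hx
        exact h2.trans (hanti (by simp at hx; omega))
      simp at this
      omega
    · have h3 := sum_range_add_sum_Ico d (show k + 1 ≤ n by omega)
      have : ∑ j ∈ Ico (k + 1) n, d j ≤ (Ico (k + 1) n).card • 1 := by
        apply sum_le_card_nsmul
        intro x hx
        have : d x ≤ d k := hanti (by simp at hx; omega)
        omega
      simp at this
      omega

lemma exist_sorted (n : ℕ) (hn : 2 ≤ n) (d : Fin n → ℕ) (hanti : Antitone d)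
    (hpos : ∀ i, 0 < d i) (hsum : ∑ i, d i = 2 * (n - 1)) :
    ∃ T : SimpleGraph (Fin n), IsBFDTree T ∧ ∀ i, gdeg T i = d i := by
  classical
  obtain ⟨C, hCm, hCn, hCs, hC0, hCi⟩ := exist_nat n hn
    (fun j => if h : j < n then d ⟨j, h⟩ else 1)
    (by
      intro i j hij
      dsimp only
      split_ifs with h1 h2
      · exact hanti (by simpa [Fin.le_def] using hij)
      · omega
      · exact hpos _
      · exact le_rfl)
    (by intro i; split_ifs; exacts [hpos _, one_pos])
    (by rw [← hsum, ← Fin.sum_univ_eq_sum_range]; simp)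
  have hex : ∀ v : Fin n, ∃ p : Fin n, v.val ≠ 0 →
      p < v ∧ C p.val < v.val ∧ v.val ≤ C (p.val + 1) := by
    intro v
    by_cases hv : v.val = 0
    · exact ⟨v, fun h => absurd hv h⟩
    have hE : ∃ i, v.val ≤ C i := ⟨v.val, hCi _ (by omega) v.2⟩
    have h1 := Nat.find_spec hE
    have h2 : Nat.find hE ≤ v.val := Nat.find_min' hE (hCi _ (by omega) v.2)
    have h3 : Nat.find hE ≠ 0 := by
      intro h
      rw [h, hC0] at h1
      omega
    have h4 := Nat.find_min hE (m := Nat.find hE - 1) (by omega)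
    refine ⟨⟨Nat.find hE - 1, by omega⟩, fun _ => ⟨?_, ?_, ?_⟩⟩
    · rw [Fin.lt_def]; dsimp only; omega
    · dsimp only; omega
    · dsimp only; rw [Nat.sub_add_cancel (by omega)]; exact h1
  choose par hpar using hex
  have hmono : ∀ u v : Fin n, u.val ≠ 0 → v.val ≠ 0 → u ≤ v → par u ≤ par v := by
    intro u v hu hv huv
    by_contra! hc
    have h1 := (hpar u hu).2.1
    have h2 := (hpar v hv).2.2
    have h3 : C ((par v).val + 1) ≤ C (par u).val := hCm hc
    rw [Fin.le_def] at huv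
    omega
  have hiff : ∀ v w : Fin n, (v.val ≠ 0 ∧ par v = w) ↔ (C w.val < v.val ∧ v.val ≤ C (w.val + 1)) := by
    intro v w
    constructor
    · rintro ⟨h, rfl⟩; exact (hpar v h).2
    · rintro ⟨h1, h2⟩
      have hv : v.val ≠ 0 := by omega
      refine ⟨hv, ?_⟩
      obtain ⟨-, h3, h4⟩ := hpar v hv
      rcases lt_trichotomy (par v) w with h | h | h
      · have : C ((par v).val + 1) ≤ C w.val := hCm h
        omega
      · exact h
      · have : C (w.val + 1) ≤ C (par v).val := hCm h
        omega
  have hfib : ∀ w : Fin n, (univ.filter (fun v : Fin n => v.val ≠ 0 ∧ par v = w)).card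
      = d w - if w.val = 0 then 0 else 1 := by
    intro w
    have h1 := hCs w.val
    simp only [w.2, dite_true] at h1
    rw [← h1, ← Nat.card_Ioc, ← card_map Fin.valEmbedding]
    congr 1
    ext x
    simp only [mem_map, mem_filter, mem_univ, true_and, Fin.valEmbedding_apply, mem_Ioc, hiff]
    constructor
    · rintro ⟨a, h, rfl⟩; exact h
    · intro h
      have : C (w.val + 1) ≤ C n := hCm (by omega)
      exact ⟨⟨x, by omega⟩, h, rfl⟩
  let T : SimpleGraph (Fin n) :=
    { Adj := fun a b => (b.val ≠ 0 ∧ par b = a) ∨ (a.val ≠ 0 ∧ par a = b)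
      symm := ⟨fun a b h => h.symm⟩
      loopless := ⟨fun a h => by
        have h : a.val ≠ 0 ∧ par a = a := by tauto
        have := (hpar a h.1).1
        rw [h.2] at this
        exact lt_irrefl _ this⟩ }
  have hadj : ∀ a b, T.Adj a b ↔ (b.val ≠ 0 ∧ par b = a) ∨ (a.val ≠ 0 ∧ par a = b) :=
    fun a b => Iff.rfl
  have hdeg : ∀ w, gdeg T w = d w := by
    intro w
    have hf := hfib w
    have hp := hpos w
    by_cases hw : w.val = 0
    · have : T.neighborSet w = (univ.filter (fun v : Fin n => v.val ≠ 0 ∧ par v = w) : Finset _) := by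
        ext x
        simp [hadj, hw]
      rw [gdeg, this, Set.ncard_coe_finset, hf]
      simp [hw]
    · have : T.neighborSet w
          = (insert (par w) (univ.filter (fun v : Fin n => v.val ≠ 0 ∧ par v = w)) : Finset _) := by
        ext x
        simp only [mem_neighborSet, hadj, coe_insert, Set.mem_insert_iff, mem_coe, mem_filter,
          mem_univ, true_and]
        constructor
        · rintro (h | h)
          · exact Or.inr h
          · exact Or.inl h.2.symm
        · rintro (h | h)
          · exact Or.inr ⟨hw, h.symm⟩
          · exact Or.inl h
      rw [gdeg, this, Set.ncard_coe_finset, card_insert_of_notMem, hf, if_neg hw]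
      · omega
      · simp only [mem_filter, mem_univ, true_and]
        rintro ⟨h1, h2⟩
        have a1 := (hpar w hw).1
        have a2 := (hpar _ h1).1
        rw [h2] at a2
        exact lt_asymm a1 a2
  let z : Fin n := ⟨0, by omega⟩
  have hz : ∀ v : Fin n, v.val ≠ 0 ↔ v ≠ z := by
    intro v; rw [Ne, Ne, Fin.ext_iff]
  have hreach : ∀ k : ℕ, ∀ v : Fin n, v.val = k → T.Reachable z v := by
    intro k
    induction k using Nat.strong_induction_on with
    | _ k ih =>
      intro v hv
      by_cases h : v.val = 0
      · have : v = z := Fin.ext h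
        rw [this]
      · have h1 : T.Adj (par v) v := (hadj _ _).2 (Or.inl ⟨h, rfl⟩)
        have h2 : (par v).val < v.val := (hpar v h).1
        exact (ih _ (by omega) (par v) rfl).trans h1.reachable
  have hconn : T.Connected := by
    have : Nonempty (Fin n) := ⟨z⟩
    exact ⟨fun a b => (hreach _ a rfl).symm.trans (hreach _ b rfl)⟩
  have htree : T.IsTree := by
    rw [isTree_iff_connected_and_card]
    refine ⟨hconn, ?_⟩
    have h1 := T.sum_degrees_eq_twice_card_edges
    have h2 : ∀ v, T.degree v = d v := by
      intro v
      rw [← hdeg, gdeg, ← card_neighborFinset_eq_degree, ← Set.ncard_coe_finset, coe_neighborFinset]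
    simp only [h2, hsum] at h1
    rw [Nat.card_eq_fintype_card, Nat.card_eq_fintype_card, Fintype.card_fin,
      ← edgeFinset_card]
    omega
  have hnodown : ∀ k : ℕ, ∀ w : Fin n, w.val ≠ 0 → T.dist z w = k →
      T.dist z (par w) = T.dist z w + 1 → False := by
    intro k
    induction k using Nat.strong_induction_on with
    | _ k ih =>
      intro w hw hk hd
      obtain ⟨q, hq, hqd⟩ := closer_exists hconn z w ((hz w).1 hw)
      rcases (hadj _ _).1 hq with ⟨-, h⟩ | ⟨h1, h2⟩
      · rw [h] at hd; omega
      · exact ih (T.dist z q) (by omega) q h1 rfl (by rw [h2]; exact hqd)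
  have hchild : ∀ w v, T.Adj w v → T.dist z v = T.dist z w + 1 → v.val ≠ 0 ∧ par v = w := by
    intro w v h hd
    rcases (hadj _ _).1 h with h | ⟨h1, h2⟩
    · exact h
    · exact (hnodown _ w h1 rfl (by rw [h2]; exact hd)).elim
  refine ⟨T, ⟨htree, z, (· < ·), inferInstance, ?_, ?_, ?_⟩, hdeg⟩
  · intro v hv
    have := (hz v).2 hv
    rw [Fin.lt_def]
    exact Nat.pos_of_ne_zero this
  · intro w₁ w₂ v₁ v₂ hlt a1 d1 a2 d2
    obtain ⟨p1, q1⟩ := hchild _ _ a1 d1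
    obtain ⟨p2, q2⟩ := hchild _ _ a2 d2
    by_contra! hc
    have := hmono _ _ p2 p1 hc
    rw [q1, q2] at this
    exact absurd hlt (not_lt.2 this)
  · intro v u h
    rw [hdeg, hdeg]
    exact hanti h.le

theorem stmt9 (n : ℕ) (hn : 1 ≤ n) (π : Fin n → ℕ) (hpos : ∀ i, 0 < π i)
    (hsum : ∑ i, π i = 2 * (n - 1)) :
    (∃ T : SimpleGraph (Fin n), IsBFDTree T ∧
        ∃ σ : Equiv.Perm (Fin n), ∀ i, gdeg T (σ i) = π i) ∧
    (∀ T T' : SimpleGraph (Fin n),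
        IsBFDTree T → (∃ σ : Equiv.Perm (Fin n), ∀ i, gdeg T (σ i) = π i) →
        IsBFDTree T' → (∃ σ : Equiv.Perm (Fin n), ∀ i, gdeg T' (σ i) = π i) →
        Nonempty (T ≃g T')) := by
  refine ⟨?_, fun T T' h1 h2 h3 h4 => uniq n hn π T T' h1 h2 h3 h4⟩
  have hn2 : 2 ≤ n := by
    by_contra hc
    have h1 : π ⟨0, hn⟩ ≤ ∑ i, π i := single_le_sum (fun _ _ => Nat.zero_le _) (mem_univ _)
    have h2 := hpos ⟨0, hn⟩
    omega
  let τ : Equiv.Perm (Fin n) := Fin.revPerm.trans (Tuple.sort π)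
  obtain ⟨T, hT, hd⟩ := exist_sorted n hn2 (fun i => π (τ i))
    (fun i j hij => Tuple.monotone_sort π (Fin.rev_le_rev.2 hij))
    (fun i => hpos _) (by rw [← hsum]; exact Equiv.sum_comp τ π)
  exact ⟨T, hT, τ.symm, fun i => by rw [hd]; simp⟩
end

section
/- A tree T with degree sequence π maximizes the largest Laplacian eigenvalue among all trees with degree sequence π if and only if T is a BFD-tree; moreover such a tree is unique up to isomorphism. -/
open SimpleGraph Finset Matrix

/-- `T` is extremal in `𝒯_π`: `T` is a tree which maximizes the largest Laplacian
eigenvalue among all trees with the same degree sequence. -/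
def ExtremalTree {V : Type*} [Fintype V] [DecidableEq V] (T : SimpleGraph V) : Prop :=
  T.IsTree ∧ ∃ lam : ℝ, IsMaxEig T lam ∧
    ∀ T'' : SimpleGraph V, T''.IsTree →
      (∃ σ : Equiv.Perm V, ∀ w, gdeg T'' (σ w) = gdeg T w) →
      ∀ lam'' : ℝ, IsMaxEig T'' lam'' → lam'' ≤ lam

open scoped Classical in
noncomputable def ds {V : Type*} [Fintype V] (T : SimpleGraph V) (ψ : V → V → ℝ) : ℝ :=
  ∑ x, ∑ y, if T.Adj x y then ψ x y else 0

lemma sum_pair {V : Type*} [Fintype V] [DecidableEq V] (w z : V) (h : w ≠ z) (ψ : V → V → ℝ) :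
    ∑ x, ∑ y, (if s(w, z) = s(x, y) then ψ x y else 0) = ψ w z + ψ z w := by
  have : ∀ x y, (if s(w, z) = s(x, y) then ψ x y else 0)
      = (if w = x then (if z = y then ψ w z else 0) else 0)
        + (if z = x then (if w = y then ψ z w else 0) else 0) := by
    intro x y
    by_cases h1 : w = x <;> by_cases h2 : z = y <;> by_cases h3 : z = x <;> by_cases h4 : w = y <;>
      simp_all
  simp only [this, Finset.sum_add_distrib]
  simp

lemma move_tree {V : Type*} [Fintype V] [DecidableEq V] (T : SimpleGraph V) (hT : T.IsTree)
    (S : Finset V) (a b : V → V) (ha : ∀ w ∈ S, T.Adj w (a w))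
    (hinj : Set.InjOn (fun w => s(w, a w)) (S : Set V)) (hb : ∀ w ∈ S, w ≠ b w)
    (hr : ∀ w ∈ S, (T.deleteEdges {e | ∃ w ∈ S, s(w, a w) = e}).Reachable (a w) (b w)) :
    ∃ T' : SimpleGraph V, T'.IsTree ∧ ∀ ψ, ds T' ψ = ds T ψ +
      ∑ w ∈ S, (ψ w (b w) + ψ (b w) w - ψ w (a w) - ψ (a w) w) := by
  classical
  set R : Finset (Sym2 V) := S.image (fun w => s(w, a w)) with hR
  set A : Finset (Sym2 V) := S.image (fun w => s(w, b w)) with hA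
  set E := T.edgeFinset with hE
  have hRE : R ⊆ E := by
    intro e he
    simp only [hR, Finset.mem_image] at he
    obtain ⟨w, hw, rfl⟩ := he
    simpa [hE] using ha w hw
  set E' := (E \ R) ∪ A with hE'
  set T' := SimpleGraph.fromEdgeSet (E' : Set (Sym2 V)) with hT'
  have hdiag : ∀ x, s(x, x) ∉ E' := by
    intro x hx
    simp only [hE', Finset.mem_union, Finset.mem_sdiff, hA, Finset.mem_image, hE,
      mem_edgeFinset] at hx
    rcases hx with hx | ⟨w, hw, hx⟩
    · exact T.loopless.irrefl _ hx.1
    · apply hb w hw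
      simp only [Sym2.eq_iff] at hx
      rcases hx with ⟨h1, h2⟩ | ⟨h1, h2⟩ <;> exact h1.trans h2.symm
  have hadj : ∀ x y, T'.Adj x y ↔ s(x, y) ∈ E' := by
    intro x y
    rw [hT', fromEdgeSet_adj]
    constructor
    · rintro ⟨h, -⟩; exact_mod_cast h
    · intro h; refine ⟨by exact_mod_cast h, ?_⟩
      rintro rfl; exact hdiag _ h
  have hES : T'.edgeFinset = E' := by
    ext e
    induction e with | _ x y => simp [hadj]
  have hF : T.deleteEdges {e | ∃ w ∈ S, s(w, a w) = e} ≤ T' := by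
    intro x y hxy
    rw [deleteEdges_adj] at hxy
    rw [hadj]
    simp only [hE', Finset.mem_union, Finset.mem_sdiff]
    left
    refine ⟨by simpa [hE] using hxy.1, ?_⟩
    simpa [hR] using hxy.2
  have hwa : ∀ w ∈ S, T'.Reachable w (a w) := by
    intro w hw
    have h1 : T'.Adj w (b w) := by
      rw [hadj]; simp only [hE', Finset.mem_union]; right
      exact Finset.mem_image_of_mem _ hw
    exact h1.reachable.trans ((hr w hw).mono hF).symm
  have hedge : ∀ x y, T.Adj x y → T'.Reachable x y := by
    intro x y hxy
    by_cases h : s(x, y) ∈ R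
    · simp only [hR, Finset.mem_image] at h
      obtain ⟨w, hw, h⟩ := h
      simp only [Sym2.eq_iff] at h
      rcases h with ⟨h1, h2⟩ | ⟨h1, h2⟩
      · subst h1 h2; exact hwa w hw
      · subst h1 h2; exact (hwa w hw).symm
    · apply Adj.reachable
      rw [hadj]
      simp only [hE', Finset.mem_union, Finset.mem_sdiff]
      left; exact ⟨by simpa [hE] using hxy, h⟩
  have hconn : T'.Connected := by
    have := hT.connected.nonempty
    refine ⟨fun x y => ?_⟩
    obtain ⟨p⟩ := hT.connected.preconnected x y
    induction p with
    | nil => exact Reachable.refl _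
    | cons h _ ih => exact (hedge _ _ h).trans ih
  have hc1 := hconn.card_vert_le_card_edgeSet_add_one
  have hc2 := (isTree_iff_connected_and_card.1 hT).2
  rw [Nat.card_eq_fintype_card (α := T'.edgeSet), ← edgeFinset_card, hES] at hc1
  rw [Nat.card_eq_fintype_card (α := T.edgeSet), ← edgeFinset_card] at hc2
  replace hc2 : E.card + 1 = Nat.card V := by convert hc2
  have hcR : R.card = S.card := Finset.card_image_of_injOn hinj
  have hcA : A.card ≤ S.card := Finset.card_image_le
  have hcER : (E \ R).card + R.card = E.card := Finset.card_sdiff_add_card_eq_card hRE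
  have hcU : E'.card + ((E \ R) ∩ A).card = (E \ R).card + A.card :=
    Finset.card_union_add_card_inter _ _
  have hAS : A.card = S.card := by omega
  have hdis : ((E \ R) ∩ A).card = 0 := by omega
  have hinjA : Set.InjOn (fun w => s(w, b w)) (S : Set V) := Finset.card_image_iff.1 hAS
  have hdis' : ∀ e, e ∈ E → e ∈ A → e ∈ R := by
    intro e h1 h2
    by_contra h3
    rw [Finset.card_eq_zero] at hdis
    have : e ∈ (E \ R) ∩ A := by simp [h1, h2, h3]
    rw [hdis] at this; simp at this
  refine ⟨T', isTree_iff_connected_and_card.2 ⟨hconn, ?_⟩, ?_⟩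
  · rw [Nat.card_eq_fintype_card (α := T'.edgeSet), ← edgeFinset_card, hES]; omega
  · intro ψ
    have key : ∀ (g : V → Sym2 V) (e : Sym2 V) (c : ℝ), Set.InjOn g (S : Set V) →
        ∑ w ∈ S, (if g w = e then c else 0) = if e ∈ S.image g then c else 0 := by
      intro g e c hg
      by_cases he : e ∈ S.image g
      · rw [if_pos he]
        obtain ⟨w, hw, rfl⟩ := Finset.mem_image.1 he
        rw [Finset.sum_eq_single w]
        · simp
        · intro w' hw' hne; rw [if_neg]; intro h; exact hne (hg hw' hw h)
        · intro h; exact absurd hw h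
      · rw [if_neg he]
        apply Finset.sum_eq_zero
        intro w hw; rw [if_neg]; rintro rfl; exact he (Finset.mem_image_of_mem _ hw)
    have hpt : ∀ x y, (@ite _ (T'.Adj x y) (Classical.propDecidable _) (ψ x y) 0) =
        (@ite _ (T.Adj x y) (Classical.propDecidable _) (ψ x y) 0)
        + ∑ w ∈ S, ((if s(w, b w) = s(x, y) then ψ x y else 0)
          - (if s(w, a w) = s(x, y) then ψ x y else 0)) := by
      intro x y
      rw [Finset.sum_sub_distrib, key _ _ _ hinj, key _ _ _ hinjA, ← hR, ← hA]
      have h1 : T'.Adj x y ↔ (s(x, y) ∈ E ∧ s(x, y) ∉ R) ∨ s(x, y) ∈ A := by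
        rw [hadj, hE']; simp
      have h2 : T.Adj x y ↔ s(x, y) ∈ E := by simp [hE]
      have h3 := hdis' s(x, y)
      have h4 := @hRE s(x, y)
      by_cases c1 : s(x, y) ∈ E <;> by_cases c2 : s(x, y) ∈ R <;> by_cases c3 : s(x, y) ∈ A <;>
        simp [h1, h2, c1, c2, c3] at h3 h4 ⊢
    unfold ds
    simp only [hpt, Finset.sum_add_distrib]
    congr 1
    have : ∀ x, ∑ y, ∑ w ∈ S, ((if s(w, b w) = s(x, y) then ψ x y else 0)
          - (if s(w, a w) = s(x, y) then ψ x y else 0)) = ∑ w ∈ S, ∑ y, ((if s(w, b w) = s(x, y) then ψ x y else 0)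
          - (if s(w, a w) = s(x, y) then ψ x y else 0)) := fun x => Finset.sum_comm
    simp only [this]
    rw [Finset.sum_comm]
    apply Finset.sum_congr rfl
    intro w hw
    simp only [Finset.sum_sub_distrib]
    rw [sum_pair w (b w) (hb w hw), sum_pair w (a w) (ha w hw).ne]
    ring

lemma gdeg_eq_sum {V : Type*} [Fintype V] [DecidableEq V] (T : SimpleGraph V) (z : V)
    [DecidablePred (T.Adj z)] :
    (gdeg T z : ℝ) = ∑ y, if T.Adj z y then 1 else 0 := by
  have : T.neighborSet z = ((Finset.univ.filter (fun y => T.Adj z y) : Finset V) : Set V) := by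
    ext y; simp
  rw [gdeg, this, Set.ncard_coe_finset]
  simp

lemma gdeg_eq_ds {V : Type*} [Fintype V] [DecidableEq V] (T : SimpleGraph V) (z : V) :
    (gdeg T z : ℝ) = ds T (fun x _ => if x = z then 1 else 0) := by
  classical
  rw [gdeg_eq_sum, ds, Finset.sum_eq_single (M := ℝ) (s := Finset.univ) (f := fun x => ∑ y, if T.Adj x y then (if x = z then (1:ℝ) else 0) else 0) z]
  · simp
  · intro b _ hb; simp [hb]
  · simp
open scoped Classical in
noncomputable def QM {V : Type*} [Fintype V] [DecidableEq V] (G : SimpleGraph V) :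
    Matrix V V ℝ :=
  Matrix.of fun u v =>
    (if u = v then (gdeg G u : ℝ) else 0) + (if G.Adj u v then 1 else 0)

lemma eig_of_eq {V : Type*} [Fintype V] [DecidableEq V] (M : Matrix V V ℝ) (hM : M.transpose = M)
    (lam : ℝ) (h : ∀ x : V → ℝ, x ⬝ᵥ M *ᵥ x ≤ lam * (x ⬝ᵥ x)) (f : V → ℝ)
    (hf : f ⬝ᵥ M *ᵥ f = lam * (f ⬝ᵥ f)) : M *ᵥ f = lam • f := by
  have hform : ∀ x : V → ℝ, x ⬝ᵥ (lam • (1 : Matrix V V ℝ) - M) *ᵥ x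
      = lam * (x ⬝ᵥ x) - x ⬝ᵥ M *ᵥ x := by
    intro x
    rw [Matrix.sub_mulVec, dotProduct_sub, Matrix.smul_mulVec, Matrix.one_mulVec, dotProduct_smul,
      smul_eq_mul]
  have hps : (lam • (1 : Matrix V V ℝ) - M).PosSemidef := by
    refine Matrix.PosSemidef.of_dotProduct_mulVec_nonneg ?_ ?_
    · rw [Matrix.IsHermitian, Matrix.conjTranspose_eq_transpose_of_trivial]
      simp [hM]
    · intro x
      rw [star_trivial, hform]
      linarith [h x]
  have h0 := (hps.dotProduct_mulVec_zero_iff f).1 (by rw [star_trivial, hform]; linarith)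
  rw [Matrix.sub_mulVec, Matrix.smul_mulVec, Matrix.one_mulVec] at h0
  exact (sub_eq_zero.1 h0).symm

lemma exists_max_s11 {V : Type*} [Fintype V] [DecidableEq V] [Nonempty V] (M : Matrix V V ℝ)
    (hM : M.transpose = M) :
    ∃ lam, IsGreatest {μ : ℝ | ∃ f : V → ℝ, f ≠ 0 ∧ M.mulVec f = μ • f} lam ∧
      ∀ x : V → ℝ, x ⬝ᵥ M *ᵥ x ≤ lam * (x ⬝ᵥ x) := by
  have hpos : ∀ x : V → ℝ, x ≠ 0 → 0 < x ⬝ᵥ x := by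
    intro x hx
    have h1 : 0 ≤ x ⬝ᵥ x := Finset.sum_nonneg (fun i _ => mul_self_nonneg _)
    rcases h1.lt_or_eq with h | h
    · exact h
    · exact absurd (dotProduct_self_eq_zero.1 h.symm) hx
  let K : Set (V → ℝ) := {x | x ⬝ᵥ x = 1}
  have hKc : IsClosed K := isClosed_eq (by unfold dotProduct; fun_prop) continuous_const
  have hK : IsCompact K := by
    refine IsCompact.of_isClosed_subset (isCompact_Icc (a := (fun _ => -1 : V → ℝ))
      (b := (fun _ => 1 : V → ℝ))) hKc ?_
    intro x hx
    have : ∀ i, x i * x i ≤ 1 := by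
      intro i
      rw [← (show x ⬝ᵥ x = 1 from hx)]
      exact Finset.single_le_sum (f := fun i => x i * x i) (fun i _ => mul_self_nonneg _)
        (Finset.mem_univ i)
    refine ⟨fun i => ?_, fun i => ?_⟩
    · show -1 ≤ x i
      nlinarith [this i]
    · show x i ≤ 1
      nlinarith [this i]
  have hKn : K.Nonempty := by
    obtain ⟨v⟩ := ‹Nonempty V›
    exact ⟨Pi.single v 1, by simp [K]⟩
  obtain ⟨x0, hx0, hmax⟩ := hK.exists_isMaxOn hKn (f := fun x => x ⬝ᵥ M *ᵥ x)
    (by unfold dotProduct Matrix.mulVec dotProduct; fun_prop)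
  have hx01 : x0 ⬝ᵥ x0 = 1 := hx0
  have hray : ∀ x : V → ℝ, x ⬝ᵥ M *ᵥ x ≤ (x0 ⬝ᵥ M *ᵥ x0) * (x ⬝ᵥ x) := by
    intro x
    by_cases hx : x = 0
    · subst hx; simp
    · have hp := hpos x hx
      set c := Real.sqrt (x ⬝ᵥ x) with hc
      have hcc : c * c = x ⬝ᵥ x := Real.mul_self_sqrt hp.le
      have hc0 : 0 < c := Real.sqrt_pos.2 hp
      have hy : (c⁻¹ • x) ∈ K := by
        show (c⁻¹ • x) ⬝ᵥ (c⁻¹ • x) = 1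
        rw [smul_dotProduct, dotProduct_smul, ← hcc]
        simp only [smul_eq_mul]; field_simp
      have := hmax hy
      simp only [Set.mem_ofPred_eq, Matrix.mulVec_smul, smul_dotProduct, dotProduct_smul, smul_eq_mul] at this
      rw [← hcc]
      have h2 : x ⬝ᵥ M *ᵥ x = c * c * (c⁻¹ * (c⁻¹ * (x ⬝ᵥ M *ᵥ x))) := by field_simp
      rw [h2, mul_comm]
      exact mul_le_mul_of_nonneg_right this (by positivity)
  refine ⟨x0 ⬝ᵥ M *ᵥ x0, ⟨⟨x0, ?_, ?_⟩, ?_⟩, hray⟩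
  · rintro rfl; simp at hx01
  · apply eig_of_eq M hM _ hray; rw [hx01, mul_one]
  · rintro μ ⟨f, hf, hfe⟩
    have h1 := hray f
    rw [hfe, dotProduct_smul, smul_eq_mul] at h1
    exact le_of_mul_le_mul_right h1 (hpos f hf)

lemma QM_apply {V : Type*} [Fintype V] [DecidableEq V] (T : SimpleGraph V) (f : V → ℝ) (z : V)
    [DecidablePred (T.Adj z)] :
    (QM T *ᵥ f) z = ∑ y, if T.Adj z y then f z + f y else 0 := by
  have : ∀ y, (if T.Adj z y then f z + f y else 0) = (if T.Adj z y then 1 else 0) * f z +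
      (if T.Adj z y then 1 else 0) * f y := by
    intro y; split_ifs <;> ring
  simp only [this, Finset.sum_add_distrib, ← Finset.sum_mul]
  rw [← gdeg_eq_sum]
  simp only [QM, Matrix.mulVec, dotProduct, Matrix.of_apply, add_mul, Finset.sum_add_distrib]
  congr 1
  · simp
  · congr! 3

lemma lap_apply {V : Type*} [Fintype V] [DecidableEq V] (T : SimpleGraph V) (f : V → ℝ) (z : V)
    [DecidablePred (T.Adj z)] :
    (lap T *ᵥ f) z = ∑ y, if T.Adj z y then f z - f y else 0 := by
  have : ∀ y, (if T.Adj z y then f z - f y else 0) = (if T.Adj z y then 1 else 0) * f z -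
      (if T.Adj z y then 1 else 0) * f y := by
    intro y; split_ifs <;> ring
  simp only [this, Finset.sum_sub_distrib, ← Finset.sum_mul]
  rw [← gdeg_eq_sum]
  simp only [lap, Matrix.mulVec, dotProduct, Matrix.of_apply, sub_mul, Finset.sum_sub_distrib]
  congr 1
  · simp
  · congr! 3

lemma QM_ds {V : Type*} [Fintype V] [DecidableEq V] (T : SimpleGraph V) (f : V → ℝ) (z : V) :
    (QM T *ᵥ f) z = ds T (fun x y => if x = z then f x + f y else 0) := by
  classical
  rw [QM_apply, ds, Finset.sum_eq_single (M := ℝ) (s := Finset.univ) (f := fun x => ∑ y, if T.Adj x y then (if x = z then f x + f y else 0) else 0) z]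
  · simp
  · intro b _ hb; simp [hb]
  · simp

lemma quad_ds {V : Type*} [Fintype V] [DecidableEq V] (T : SimpleGraph V) (f : V → ℝ) :
    f ⬝ᵥ QM T *ᵥ f = ds T (fun x y => f x * (f x + f y)) := by
  classical
  simp only [ds, dotProduct, QM_apply, Finset.mul_sum, mul_ite, mul_zero]

lemma QM_symm {V : Type*} [Fintype V] [DecidableEq V] (T : SimpleGraph V) :
    (QM T).transpose = QM T := by
  classical
  ext u v
  simp only [QM, Matrix.transpose_apply, Matrix.of_apply]
  rw [if_congr (T.adj_comm v u) rfl rfl]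
  congr 1
  by_cases h : u = v
  · subst h; rfl
  · simp [h, Ne.symm h]
structure Rt {V : Type*} (T : SimpleGraph V) (v₀ : V) (p : V → V) : Prop where
  conn : T.Connected
  adj : ∀ v, v ≠ v₀ → T.Adj v (p v)
  dist : ∀ v, v ≠ v₀ → T.dist v₀ v = T.dist v₀ (p v) + 1
  out : ∀ u v, T.Adj u v → (u ≠ v₀ ∧ p u = v) ∨ (v ≠ v₀ ∧ p v = u)

lemma exists_rt {V : Type*} [Fintype V] [DecidableEq V] (T : SimpleGraph V) (hT : T.IsTree)
    (v₀ : V) : ∃ p, Rt T v₀ p := by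
  classical
  have hstep : ∀ v, ∃ w, v ≠ v₀ → T.Adj v w ∧ T.dist v₀ v = T.dist v₀ w + 1 := by
    intro v
    by_cases hv : v = v₀
    · exact ⟨v, fun h => absurd hv h⟩
    · obtain ⟨q, hq⟩ := hT.connected.exists_walk_length_eq_dist v v₀
      cases q with
      | nil => exact absurd rfl hv
      | @cons _ w _ h q =>
        refine ⟨w, fun _ => ⟨h, ?_⟩⟩
        have h1 := SimpleGraph.dist_le q
        have h2 := hT.connected.dist_triangle (u := v) (v := w) (w := v₀)
        rw [SimpleGraph.dist_eq_one_iff_adj.2 h] at h2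
        simp only [Walk.length_cons] at hq
        rw [T.dist_comm (u := v₀) (v := v), T.dist_comm (u := v₀) (v := w)]
        omega
  choose p hp using hstep
  refine ⟨p, hT.connected, fun v hv => (hp v hv).1, fun v hv => (hp v hv).2, ?_⟩
  have hc := hT.card_edgeFinset
  have hinj : Set.InjOn (fun v => s(v, p v)) ((Finset.univ.erase v₀ : Finset V) : Set V) := by
    intro u hu v hv huv
    simp only [Finset.coe_erase, Finset.coe_univ, Set.mem_sdiff, Set.mem_univ, true_and,
      Set.mem_singleton_iff] at hu hv
    simp only [Sym2.eq_iff] at huv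
    rcases huv with h | ⟨h1, h2⟩
    · exact h.1
    · have e1 := (hp u hu).2
      have e2 := (hp v hv).2
      rw [h2] at e1; rw [← h1] at e2; omega
  have hsub : (Finset.univ.erase v₀).image (fun v => s(v, p v)) ⊆ T.edgeFinset := by
    intro e he
    obtain ⟨v, hv, rfl⟩ := Finset.mem_image.1 he
    simpa using (hp v (Finset.ne_of_mem_erase hv)).1
  have heq := Finset.eq_of_subset_of_card_le hsub (by
    rw [Finset.card_image_of_injOn hinj, Finset.card_erase_of_mem (Finset.mem_univ _),
      Finset.card_univ]
    omega)
  intro u v huv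
  have : s(u, v) ∈ T.edgeFinset := by simpa using huv
  rw [← heq] at this
  obtain ⟨w, hw, hwe⟩ := Finset.mem_image.1 this
  have hw' := Finset.ne_of_mem_erase hw
  simp only [Sym2.eq_iff] at hwe
  rcases hwe with ⟨h1, h2⟩ | ⟨h1, h2⟩
  · left; subst h1; exact ⟨hw', h2⟩
  · right; subst h1; exact ⟨hw', h2⟩

lemma Rt.child {V : Type*} {T : SimpleGraph V} {v₀ : V} {p : V → V} (h : Rt T v₀ p) {u v : V}
    (ha : T.Adj u v) (hd : T.dist v₀ v = T.dist v₀ u + 1) : v ≠ v₀ ∧ p v = u := by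
  rcases h.out u v ha with ⟨h1, h2⟩ | h1
  · have := h.dist u h1
    rw [h2] at this; omega
  · exact h1

lemma maxEig_iff {V : Type*} [Fintype V] [DecidableEq V] (T : SimpleGraph V) (hT : T.IsTree)
    (lam : ℝ) : IsMaxEig T lam ↔
      IsGreatest {μ : ℝ | ∃ f : V → ℝ, f ≠ 0 ∧ (QM T).mulVec f = μ • f} lam := by
  classical
  obtain ⟨v₀⟩ := hT.connected.nonempty
  obtain ⟨p, hp⟩ := exists_rt T hT v₀
  let ε : V → ℝ := fun v => (-1) ^ (T.dist v₀ v)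
  have hε2 : ∀ v, ε v * ε v = 1 := by
    intro v; simp only [ε, ← mul_pow]; norm_num
  have hεa : ∀ u v, T.Adj u v → ε v = - ε u := by
    intro u v huv
    rcases hp.out u v huv with ⟨h1, h2⟩ | ⟨h1, h2⟩
    · have := hp.dist u h1
      simp only [ε, this, h2, pow_succ]; ring
    · have := hp.dist v h1
      simp only [ε, this, h2, pow_succ]; ring
  have hLQ : ∀ f : V → ℝ, ∀ z, (lap T *ᵥ (fun v => ε v * f v)) z = ε z * (QM T *ᵥ f) z := by
    intro f z
    rw [lap_apply, QM_apply, Finset.mul_sum]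
    apply Finset.sum_congr rfl
    intro y _
    split_ifs with h
    · rw [hεa z y h]; ring
    · simp
  have hne : ∀ f : V → ℝ, f ≠ 0 → (fun v => ε v * f v) ≠ 0 := by
    intro f hf h0
    apply hf
    funext v
    have h1 := congrFun h0 v
    simp only [Pi.zero_apply] at h1 ⊢
    calc f v = ε v * ε v * f v := by rw [hε2, one_mul]
      _ = ε v * (ε v * f v) := by ring
      _ = 0 := by rw [h1, mul_zero]
  have hset : {μ : ℝ | ∃ f : V → ℝ, f ≠ 0 ∧ (lap T).mulVec f = μ • f} =
      {μ : ℝ | ∃ f : V → ℝ, f ≠ 0 ∧ (QM T).mulVec f = μ • f} := by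
    ext μ
    constructor
    · rintro ⟨f, hf, hfe⟩
      refine ⟨fun v => ε v * f v, hne f hf, ?_⟩
      funext z
      have h1 := hLQ (fun v => ε v * f v) z
      have h2 : (fun v => ε v * (ε v * f v)) = f := by
        funext v; rw [← mul_assoc, hε2, one_mul]
      rw [h2, hfe] at h1
      simp only [Pi.smul_apply, smul_eq_mul] at h1 ⊢
      calc (QM T *ᵥ fun v => ε v * f v) z = ε z * ε z * (QM T *ᵥ fun v => ε v * f v) z := by
              rw [hε2, one_mul]
        _ = ε z * (μ * f z) := by rw [h1]; ring
        _ = _ := by ring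
    · rintro ⟨f, hf, hfe⟩
      refine ⟨fun v => ε v * f v, hne f hf, ?_⟩
      funext z
      rw [hLQ, hfe]
      simp only [Pi.smul_apply, smul_eq_mul]; ring
  unfold IsMaxEig
  rw [hset]

lemma exists_maxEig {V : Type*} [Fintype V] [DecidableEq V] (T : SimpleGraph V) (hT : T.IsTree) :
    ∃ lam, IsMaxEig T lam ∧ ∀ x : V → ℝ, x ⬝ᵥ QM T *ᵥ x ≤ lam * (x ⬝ᵥ x) := by
  have := hT.connected.nonempty
  obtain ⟨lam, h1, h2⟩ := exists_max_s11 (QM T) (QM_symm T)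
  exact ⟨lam, (maxEig_iff T hT lam).2 h1, h2⟩

def Opt {V : Type*} [Fintype V] [DecidableEq V] (T : SimpleGraph V) (f : V → ℝ) : Prop :=
  (∀ x, 0 < f x) ∧ ∀ T' : SimpleGraph V, T'.IsTree →
    (∃ σ : Equiv.Perm V, ∀ w, gdeg T' (σ w) = gdeg T w) →
    f ⬝ᵥ QM T' *ᵥ f ≤ f ⬝ᵥ QM T *ᵥ f ∧
    (f ⬝ᵥ QM T' *ᵥ f = f ⬝ᵥ QM T *ᵥ f → QM T' *ᵥ f = QM T *ᵥ f)

lemma ext_opt {V : Type*} [Fintype V] [DecidableEq V] (T : SimpleGraph V) (h : ExtremalTree T) :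
    ∃ f, Opt T f := by
  classical
  obtain ⟨hT, lam, hlam, hext⟩ := h
  obtain ⟨lam', hlam', hray⟩ := exists_maxEig T hT
  obtain rfl := hlam.unique hlam'
  obtain ⟨f0, hf0, hf0e⟩ := ((maxEig_iff T hT lam).1 hlam).1
  let f : V → ℝ := fun v => |f0 v|
  have hff : f ⬝ᵥ f = f0 ⬝ᵥ f0 := by
    simp [f, dotProduct]
  have hq : f ⬝ᵥ QM T *ᵥ f = lam * (f ⬝ᵥ f) := by
    apply le_antisymm (hray f)
    have : f0 ⬝ᵥ QM T *ᵥ f0 = lam * (f ⬝ᵥ f) := by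
      rw [hf0e, dotProduct_smul, smul_eq_mul, hff]
    rw [← this, quad_ds, quad_ds, ds, ds]
    apply Finset.sum_le_sum; intro x _
    apply Finset.sum_le_sum; intro y _
    split_ifs
    · simp only [f, mul_add, abs_mul_abs_self]
      have := le_abs_self (f0 x * f0 y)
      rw [abs_mul] at this
      linarith
    · exact le_refl _
  have hfe := eig_of_eq (QM T) (QM_symm T) lam hray f hq
  have hnn : ∀ x, 0 ≤ f x := fun x => abs_nonneg _
  have hprop : ∀ x y, T.Adj x y → f x = 0 → f y = 0 := by
    intro x y hxy hx
    have h1 := congrFun hfe x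
    rw [QM_apply] at h1
    simp only [Pi.smul_apply, hx, smul_zero, zero_add] at h1
    have h2 := (Finset.sum_eq_zero_iff_of_nonneg (by
      intro i _; split_ifs
      · exact hnn i
      · exact le_refl _)).1 h1 y (Finset.mem_univ y)
    simpa [hxy] using h2
  have hpos : ∀ x, 0 < f x := by
    intro x
    rcases (hnn x).lt_or_eq with h | h
    · exact h
    · exfalso
      apply hf0
      funext y
      obtain ⟨q⟩ := hT.connected.preconnected x y
      have : ∀ (a b : V) (q : T.Walk a b), f a = 0 → f b = 0 := by
        intro a b q
        induction q with
        | nil => exact id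
        | cons h _ ih => exact fun h0 => ih (hprop _ _ h h0)
      exact abs_eq_zero.1 (this x y q h.symm)
  refine ⟨f, hpos, ?_⟩
  intro T' hT' hσ
  obtain ⟨l', hl', hray'⟩ := exists_maxEig T' hT'
  have hle := hext T' hT' hσ l' hl'
  have hff0 : 0 ≤ f ⬝ᵥ f := Finset.sum_nonneg (fun i _ => mul_self_nonneg _)
  have hray'' : ∀ x : V → ℝ, x ⬝ᵥ QM T' *ᵥ x ≤ lam * (x ⬝ᵥ x) := by
    intro x
    refine (hray' x).trans (mul_le_mul_of_nonneg_right hle ?_)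
    exact Finset.sum_nonneg (fun i _ => mul_self_nonneg _)
  rw [hq]
  refine ⟨hray'' f, fun he => ?_⟩
  rw [hfe]
  exact eig_of_eq (QM T') (QM_symm T') lam hray'' f he
lemma opt_move {V : Type*} [Fintype V] [DecidableEq V] (T : SimpleGraph V) (hT : T.IsTree)
    (f : V → ℝ) (hf : Opt T f)
    (S : Finset V) (a b : V → V) (ha : ∀ w ∈ S, T.Adj w (a w))
    (hinj : Set.InjOn (fun w => s(w, a w)) (S : Set V)) (hb : ∀ w ∈ S, w ≠ b w)
    (hr : ∀ w ∈ S, (T.deleteEdges {e | ∃ w ∈ S, s(w, a w) = e}).Reachable (a w) (b w))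
    (hσ : ∃ σ : Equiv.Perm V, ∀ x, (gdeg T (σ x) : ℝ) + ∑ w ∈ S,
      ((if b w = σ x then (1 : ℝ) else 0) - (if a w = σ x then 1 else 0)) = gdeg T x) :
    ∑ w ∈ S, (f (b w) - f (a w)) * (f (a w) + f (b w) + 2 * f w) ≤ 0 ∧
    (∑ w ∈ S, (f (b w) - f (a w)) * (f (a w) + f (b w) + 2 * f w) = 0 → ∀ z, ∑ w ∈ S,
      ((if w = z then f (b w) - f (a w) else 0) + (if b w = z then f (b w) + f w else 0)
        - (if a w = z then f (a w) + f w else 0)) = 0) := by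
  obtain ⟨T', hT', hds⟩ := move_tree T hT S a b ha hinj hb hr
  obtain ⟨σ, hσ⟩ := hσ
  obtain ⟨h1, h2⟩ := hf.2 T' hT' ⟨σ, by
    intro x
    have := hσ x
    have h3 : (gdeg T' (σ x) : ℝ) = gdeg T x := by
      rw [← this, gdeg_eq_ds T', hds, ← gdeg_eq_ds]
      congr 1
      apply Finset.sum_congr rfl
      intro w _
      ring
    exact_mod_cast h3⟩
  have hq : f ⬝ᵥ QM T' *ᵥ f = f ⬝ᵥ QM T *ᵥ f +
      ∑ w ∈ S, (f (b w) - f (a w)) * (f (a w) + f (b w) + 2 * f w) := by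
    rw [quad_ds, hds, ← quad_ds]
    congr 1
    apply Finset.sum_congr rfl
    intro w _
    ring
  refine ⟨by linarith, fun h0 z => ?_⟩
  have h3 := congrFun (h2 (by rw [hq, h0, add_zero])) z
  rw [QM_ds, hds, ← QM_ds] at h3
  have h4 := add_eq_left.1 h3
  refine Eq.trans ?_ h4
  apply Finset.sum_congr rfl
  intro w _
  split_ifs <;> ring

lemma opt_switch {V : Type*} [Fintype V] [DecidableEq V] (T : SimpleGraph V) (hT : T.IsTree)
    (f : V → ℝ) (hf : Opt T f) (u₁ u₂ v₁ v₂ : V) (h1 : T.Adj u₁ v₁) (h2 : T.Adj u₂ v₂)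
    (huu : u₁ ≠ u₂) (hvv : v₁ ≠ v₂) (h12 : u₁ ≠ v₂) (h21 : u₂ ≠ v₁)
    (hr : (T.deleteEdges {s(u₁, v₁), s(u₂, v₂)}).Reachable v₁ v₂)
    (hv : f v₂ ≤ f v₁) (hu : f u₁ ≤ f u₂) : f v₁ = f v₂ ∧ f u₁ = f u₂ := by
  have hset : {e | ∃ w ∈ ({u₁, u₂} : Finset V), s(w, if w = u₁ then v₁ else v₂) = e} =
      ({s(u₁, v₁), s(u₂, v₂)} : Set (Sym2 V)) := by
    ext e
    simp only [Finset.mem_insert, Finset.mem_singleton, exists_eq_or_imp, exists_eq_left, if_true,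
      if_neg huu.symm, Set.mem_ofPred_eq, Set.mem_insert_iff, Set.mem_singleton_iff]
    rw [eq_comm (a := e), eq_comm (a := e)]
  obtain ⟨g1, g2⟩ := opt_move T hT f hf {u₁, u₂} (fun w => if w = u₁ then v₁ else v₂)
    (fun w => if w = u₁ then v₂ else v₁)
    (by simp [huu.symm, h1, h2])
    (by
      intro x hx y hy hxy
      simp only [Finset.coe_insert, Finset.coe_singleton, Set.mem_insert_iff,
        Set.mem_singleton_iff] at hx hy
      rcases hx with rfl | rfl <;> rcases hy with rfl | rfl <;>
        simp [huu, huu.symm, h12, h21, Ne.symm h12, Ne.symm h21] at hxy ⊢)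
    (by simp [huu.symm, h12, h21])
    (by
      rw [hset]
      simp only [Finset.mem_insert, Finset.mem_singleton, forall_eq_or_imp, forall_eq, if_true,
        if_neg huu.symm]
      exact ⟨hr, hr.symm⟩)
    ⟨Equiv.refl V, by
      intro x
      rw [Finset.sum_pair huu]
      simp [huu.symm]⟩
  rw [Finset.sum_pair huu] at g1 g2
  simp only [if_true, if_neg huu.symm] at g1 g2
  have h0 : (f v₂ - f v₁) * (f v₁ + f v₂ + 2 * f u₁) + (f v₁ - f v₂) * (f v₂ + f v₁ + 2 * f u₂) = 0 := by
    apply le_antisymm g1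
    nlinarith [mul_nonneg (sub_nonneg.2 hv) (sub_nonneg.2 hu)]
  have g3 := g2 h0
  have e1 := g3 v₁
  have e2 := g3 u₁
  rw [Finset.sum_pair huu] at e1 e2
  simp [huu.symm, hvv.symm, h21, h1.ne, h1.ne.symm, Ne.symm h12] at e1 e2
  constructor <;> linarith

lemma Rt.dist_iter {V : Type*} {T : SimpleGraph V} {v₀ : V} {p : V → V} (h : Rt T v₀ p) (x : V)
    (k : ℕ) (hk : k ≤ T.dist v₀ x) : T.dist v₀ (p^[k] x) + k = T.dist v₀ x := by
  induction k with
  | zero => simp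
  | succ k ih =>
    have h1 := ih (by omega)
    have h2 : p^[k] x ≠ v₀ := by
      intro h0; rw [h0, SimpleGraph.dist_self] at h1; omega
    have h3 := h.dist _ h2
    rw [Function.iterate_succ_apply']
    omega

lemma Rt.iter_root {V : Type*} {T : SimpleGraph V} {v₀ : V} {p : V → V} (h : Rt T v₀ p) (x : V) :
    p^[T.dist v₀ x] x = v₀ := by
  have h1 := h.dist_iter x _ le_rfl
  have h2 : T.dist v₀ (p^[T.dist v₀ x] x) = 0 := by omega
  exact (h.conn.dist_eq_zero_iff.1 h2).symm

lemma Rt.reach {V : Type*} {T : SimpleGraph V} {v₀ : V} {p : V → V} (h : Rt T v₀ p)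
    (R : Set (Sym2 V)) (x : V) (m : ℕ) (hm : m ≤ T.dist v₀ x)
    (hR : ∀ y, ∀ k < m, y = p^[k] x → T.dist v₀ y + k = T.dist v₀ x → y ≠ v₀ → s(y, p y) ∉ R) :
    (T.deleteEdges R).Reachable x (p^[m] x) := by
  induction m with
  | zero => exact Reachable.refl _
  | succ m ih =>
    refine (ih (by omega) (fun y k hk => hR y k (by omega))).trans ?_
    apply Adj.reachable
    have h1 := h.dist_iter x m (by omega)
    have h2 : p^[m] x ≠ v₀ := by
      intro h0; rw [h0, SimpleGraph.dist_self] at h1; omega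
    rw [Function.iterate_succ_apply', deleteEdges_adj]
    exact ⟨h.adj _ h2, hR _ m (by omega) rfl h1 h2⟩

lemma Rt.edge_inj {V : Type*} {T : SimpleGraph V} {v₀ : V} {p : V → V} (h : Rt T v₀ p) (y z : V)
    (hy : y ≠ v₀) (hz : z ≠ v₀) (he : s(y, p y) = s(z, p z)) : y = z := by
  simp only [Sym2.eq_iff] at he
  rcases he with h1 | ⟨h1, h2⟩
  · exact h1.1
  · have e1 := h.dist y hy
    have e2 := h.dist z hz
    rw [h2] at e1; rw [← h1] at e2; omega

lemma opt_shift {V : Type*} [Fintype V] [DecidableEq V] (T : SimpleGraph V) (hT : T.IsTree)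
    (f : V → ℝ) (hf : Opt T f) (u v : V) (huv : f v ≤ f u) : gdeg T v ≤ gdeg T u := by
  classical
  by_contra hlt
  push Not at hlt
  have hne : v ≠ u := by rintro rfl; omega
  obtain ⟨p, hp⟩ := exists_rt T hT u
  have hdu : 1 ≤ gdeg T u := by
    obtain ⟨p', hp'⟩ := exists_rt T hT v
    have h1 := hp'.adj u hne.symm
    exact (Set.ncard_pos).2 ⟨p' u, h1⟩
  let N : Finset V := Finset.univ.filter (fun w => T.Adj v w)
  have hN : N.card = gdeg T v := by
    have : T.neighborSet v = (N : Set V) := by ext y; simp [N]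
    rw [gdeg, this, Set.ncard_coe_finset]
  have hpv : p v ∈ N := by simpa [N] using hp.adj v hne
  obtain ⟨S, hSN, hSc⟩ := Finset.exists_subset_card_eq (s := N.erase (p v))
    (n := gdeg T v - gdeg T u) (by rw [Finset.card_erase_of_mem hpv]; omega)
  have hS : ∀ w ∈ S, T.Adj v w ∧ w ≠ u ∧ p w = v := by
    intro w hw
    have h1 := hSN hw
    rw [Finset.mem_erase] at h1
    have h2 : T.Adj v w := by simpa [N] using h1.2
    refine ⟨h2, ?_⟩
    rcases hp.out v w h2 with h3 | h3
    · exact absurd h3.2.symm h1.1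
    · exact h3
  have hreach : (T.deleteEdges {e | ∃ w ∈ S, s(w, v) = e}).Reachable v u := by
    have := hp.reach {e | ∃ w ∈ S, s(w, v) = e} v _ le_rfl (by
      intro y k hk hy hd hyu
      rintro ⟨w, hw, he⟩
      obtain ⟨w1, w2, w3⟩ := hS w hw
      have h4 : y = w := hp.edge_inj y w hyu w2 (by rw [w3]; exact he.symm)
      have h5 := hp.dist w w2
      rw [w3] at h5
      rw [h4] at hd
      omega)
    rwa [hp.iter_root] at this
  obtain ⟨g1, g2⟩ := opt_move T hT f hf S (fun _ => v) (fun _ => u)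
    (fun w hw => (hS w hw).1.symm)
    (by
      intro x hx y hy hxy
      simp only [Sym2.eq_iff] at hxy
      rcases hxy with h | ⟨h1, h2⟩
      · exact h.1
      · exact h1.trans h2)
    (fun w hw => (hS w hw).2.1)
    (fun w hw => hreach)
    ⟨Equiv.swap u v, by
      intro x
      rw [Finset.sum_const, hSc, nsmul_eq_mul, Nat.cast_sub hlt.le]
      by_cases hxu : x = u
      · subst hxu; simp [hne, hne.symm]
      · by_cases hxv : x = v
        · subst hxv; simp [hne]
        · rw [Equiv.swap_apply_of_ne_of_ne hxu hxv]
          simp [Ne.symm hxu, Ne.symm hxv]⟩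
  have hge : 0 ≤ ∑ w ∈ S, (f u - f v) * (f v + f u + 2 * f w) := by
    apply Finset.sum_nonneg
    intro w _
    have h1 := hf.1 u
    have h2 := hf.1 v
    have h3 := hf.1 w
    exact mul_nonneg (by linarith) (by linarith)
  have h0 := g2 (le_antisymm g1 hge) u
  have hSne : S.Nonempty := by rw [← Finset.card_pos]; omega
  have : 0 < ∑ w ∈ S, ((if w = u then f u - f v else 0) + (if u = u then f u + f w else 0)
        - (if v = u then f v + f w else 0)) := by
    apply Finset.sum_pos _ hSne
    intro w hw
    rw [if_neg (hS w hw).2.1, if_pos rfl, if_neg hne]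
    linarith [hf.1 u, hf.1 w]
  linarith

lemma opt_case1 {V : Type*} [Fintype V] [DecidableEq V] (T : SimpleGraph V) (hT : T.IsTree)
    (f : V → ℝ) (hf : Opt T f) {v₀ : V} {p : V → V} (hp : Rt T v₀ p) (a b : V) (ha : a ≠ v₀)
    (hb : b ≠ v₀) (hd : T.dist v₀ a ≤ T.dist v₀ b)
    (hanc : p^[T.dist v₀ b - T.dist v₀ a] b ≠ a) (hpp : p a ≠ p b) (hle : f (p b) ≤ f (p a)) :
    f b ≤ f a := by
  by_contra hlt
  push Not at hlt
  have hab : a ≠ b := by rintro rfl; exact hpp rfl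
  have da := hp.dist a ha
  have db := hp.dist b hb
  have r1 := hp.reach {s(a, p a), s(b, p b)} (p a) _ le_rfl (by
    intro y k hk hy hdy hyv he
    simp only [Set.mem_insert_iff, Set.mem_singleton_iff] at he
    rcases he with he | he
    · have := hp.edge_inj y a hyv ha he
      subst this; omega
    · have := hp.edge_inj y b hyv hb he
      subst this; omega)
  have r2 := hp.reach {s(a, p a), s(b, p b)} (p b) _ le_rfl (by
    intro y k hk hy hdy hyv he
    simp only [Set.mem_insert_iff, Set.mem_singleton_iff] at he
    rcases he with he | he
    · have := hp.edge_inj y a hyv ha he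
      apply hanc
      rw [← Function.iterate_succ_apply, this] at hy
      rw [this] at hdy
      have : T.dist v₀ b - T.dist v₀ a = k.succ := by omega
      rw [this]; exact hy.symm
    · have := hp.edge_inj y b hyv hb he
      subst this; omega)
  rw [hp.iter_root] at r1 r2
  have := opt_switch T hT f hf a b (p a) (p b) (hp.adj a ha) (hp.adj b hb) hab hpp
    (by
      intro h; apply hanc
      rw [h, db, show T.dist v₀ (p b) + 1 - T.dist v₀ (p b) = 1 by omega]; rfl)
    (by
      intro h; rw [h] at hd; omega)
    (r1.trans r2.symm) hle hlt.le
  linarith [this.2]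

lemma opt_level {V : Type*} [Fintype V] [DecidableEq V] (T : SimpleGraph V) (hT : T.IsTree)
    (f : V → ℝ) (hf : Opt T f) {v₀ : V} {p : V → V} (hp : Rt T v₀ p) (hmax : ∀ v, f v ≤ f v₀)
    (n : ℕ) : ∀ a b, T.dist v₀ a = n → n < T.dist v₀ b → f b ≤ f a := by
  induction n with
  | zero =>
    intro a b ha hb
    rw [← hp.conn.dist_eq_zero_iff.1 ha]
    exact hmax b
  | succ n ih =>
    intro a b hda hdb
    have ha : a ≠ v₀ := by rintro rfl; simp at hda
    have hb : b ≠ v₀ := by rintro rfl; simp at hdb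
    have da := hp.dist a ha
    have db := hp.dist b hb
    by_cases hanc : p^[T.dist v₀ b - T.dist v₀ a] b = a
    · by_contra hlt
      push Not at hlt
      obtain ⟨m, hm⟩ : ∃ m, T.dist v₀ b - T.dist v₀ a = m + 1 := ⟨_, (Nat.succ_pred_eq_of_pos (by omega)).symm⟩
      have hdx := hp.dist_iter b m (by omega)
      set x := p^[m] b with hx
      have hxv : x ≠ v₀ := by
        intro h; rw [h, SimpleGraph.dist_self] at hdx; omega
      have hxa : p x = a := by
        rw [hm, Function.iterate_succ_apply'] at hanc; exact hanc
      have hdega : 1 < gdeg T a := by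
        rw [gdeg, Set.one_lt_ncard]
        refine ⟨p a, hp.adj a ha, x, ?_, ?_⟩
        · have := (hp.adj x hxv).symm
          rw [hxa] at this; exact this
        · intro h; rw [h] at da; omega
      have hdegb : 1 < gdeg T b := lt_of_lt_of_le hdega (opt_shift T hT f hf b a hlt.le)
      obtain ⟨c, hc, hcp⟩ := Set.exists_ne_of_one_lt_ncard hdegb (p b)
      have hc' : c ≠ v₀ ∧ p c = b := by
        rcases hp.out b c hc with h | h
        · exact absurd h.2.symm hcp
        · exact h
      have dc := hp.dist c hc'.1
      rw [hc'.2] at dc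
      have r := hp.reach {s(c, b), s(p a, a)} b (T.dist v₀ b - T.dist v₀ a) (by omega) (by
        intro y k hk hy hdy hyv he
        simp only [Set.mem_insert_iff, Set.mem_singleton_iff] at he
        rcases he with he | he
        · have := hp.edge_inj y c hyv hc'.1 (by rw [hc'.2]; exact he)
          subst this; omega
        · have := hp.edge_inj y a hyv ha (by rw [he]; exact Sym2.eq_swap)
          subst this; omega)
      rw [hanc] at r
      have := opt_switch T hT f hf c (p a) b a hc.symm (hp.adj a ha).symm
        (by intro h; rw [← h] at da; omega) (by intro h; rw [h] at hdb; omega)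
        (by intro h; rw [h] at dc; omega)
        (by intro h; rw [h] at da; omega) r hlt.le
        (ih (p a) c (by omega) (by omega))
      linarith [this.1]
    · exact opt_case1 T hT f hf hp a b ha hb (by omega) hanc
        (by intro h; rw [h] at da; omega) (ih (p a) (p b) (by omega) (by omega))
def ltn {V : Type*} (p : V → V) (f : V → ℝ) (e : V → ℕ) : ℕ → V → V → Prop
  | 0, _, _ => False
  | n + 1, v, u => ltn p f e n (p v) (p u) ∨
      (p v = p u ∧ (f u < f v ∨ (f v = f u ∧ e v < e u)))

lemma ltn_irrefl {V : Type*} (p : V → V) (f : V → ℝ) (e : V → ℕ) (n : ℕ) :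
    ∀ v, ¬ ltn p f e n v v := by
  induction n with
  | zero => intro v h; exact h
  | succ n ih =>
    intro v h
    rcases h with h | ⟨-, h | ⟨-, h⟩⟩
    · exact ih _ h
    · exact lt_irrefl _ h
    · exact lt_irrefl _ h

lemma ltn_trans {V : Type*} (p : V → V) (f : V → ℝ) (e : V → ℕ) (n : ℕ) :
    ∀ a b c, ltn p f e n a b → ltn p f e n b c → ltn p f e n a c := by
  induction n with
  | zero => intro a b c h; exact h.elim
  | succ n ih =>
    intro a b c h1 h2
    rcases h1 with h1 | ⟨e1, h1⟩ <;> rcases h2 with h2 | ⟨e2, h2⟩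
    · exact Or.inl (ih _ _ _ h1 h2)
    · left; rw [← e2]; exact h1
    · left; rw [e1]; exact h2
    · right
      refine ⟨e1.trans e2, ?_⟩
      rcases h1 with h1 | ⟨g1, h1⟩ <;> rcases h2 with h2 | ⟨g2, h2⟩
      · left; linarith
      · left; linarith
      · left; linarith
      · right; exact ⟨g1.trans g2, h1.trans h2⟩

lemma opt_bfd {V : Type*} [Fintype V] [DecidableEq V] (T : SimpleGraph V) (hT : T.IsTree)
    (f : V → ℝ) (hf : Opt T f) : IsBFDTree T := by
  have hne := hT.connected.nonempty
  obtain ⟨v₀, hmax⟩ := Finite.exists_max f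
  obtain ⟨p, hp⟩ := exists_rt T hT v₀
  let e : V → ℕ := fun v => (Fintype.equivFin V v : ℕ)
  have he : Function.Injective e := fun a b h => (Fintype.equivFin V).injective (Fin.ext h)
  have hnv : ∀ n v, T.dist v₀ v = n + 1 → v ≠ v₀ := by
    rintro n v h rfl; simp at h
  have htri : ∀ n, ∀ a b, T.dist v₀ a = n → T.dist v₀ b = n →
      ltn p f e n a b ∨ a = b ∨ ltn p f e n b a := by
    intro n
    induction n with
    | zero =>
      intro a b ha hb
      right; left
      rw [← hp.conn.dist_eq_zero_iff.1 ha, ← hp.conn.dist_eq_zero_iff.1 hb]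
    | succ n ih =>
      intro a b ha hb
      have da := hp.dist a (hnv n a ha)
      have db := hp.dist b (hnv n b hb)
      rcases ih (p a) (p b) (by omega) (by omega) with h | h | h
      · exact Or.inl (Or.inl h)
      · rcases lt_trichotomy (f a) (f b) with h1 | h1 | h1
        · right; right; right; exact ⟨h.symm, Or.inl h1⟩
        · rcases lt_trichotomy (e a) (e b) with h2 | h2 | h2
          · left; right; exact ⟨h, Or.inr ⟨h1, h2⟩⟩
          · right; left; exact he h2
          · right; right; right; exact ⟨h.symm, Or.inr ⟨h1.symm, h2⟩⟩
        · left; right; exact ⟨h, Or.inl h1⟩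
      · exact Or.inr (Or.inr (Or.inl h))
  have hmono : ∀ n, ∀ a b, T.dist v₀ a = n → T.dist v₀ b = n → ltn p f e n a b → f b ≤ f a := by
    intro n
    induction n with
    | zero => intro a b _ _ h; exact h.elim
    | succ n ih =>
      intro a b ha hb h
      have ha' := hnv n a ha
      have hb' := hnv n b hb
      have da := hp.dist a ha'
      have db := hp.dist b hb'
      rcases h with h | ⟨-, h | h⟩
      · have hpp : p a ≠ p b := by
          intro hh; rw [hh] at h; exact ltn_irrefl p f e n _ h
        refine opt_case1 T hT f hf hp a b ha' hb' (by omega) ?_ hpp (ih _ _ (by omega) (by omega) h)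
        rw [ha, hb, Nat.sub_self]
        intro hh
        apply hpp
        rw [show b = a from hh]
      · exact h.le
      · exact h.1.symm.le
  let lt : V → V → Prop := fun v u => T.dist v₀ v < T.dist v₀ u ∨
    (T.dist v₀ v = T.dist v₀ u ∧ ltn p f e (T.dist v₀ v) v u)
  refine ⟨hT, v₀, lt, ?_, ?_, ?_, ?_⟩
  · refine { trichotomous := ?_, irrefl := ?_, trans := ?_ }
    · intro a b h1 h2
      rcases lt_trichotomy (T.dist v₀ a) (T.dist v₀ b) with h | h | h
      · exact absurd (Or.inl h) h1
      · rcases htri _ a b rfl h.symm with g | g | g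
        · exact absurd (Or.inr ⟨h, g⟩) h1
        · exact g
        · exact absurd (Or.inr ⟨h.symm, h ▸ g⟩) h2
      · exact absurd (Or.inl h) h2
    · rintro a (h | ⟨-, h⟩)
      · exact lt_irrefl _ h
      · exact ltn_irrefl _ _ _ _ _ h
    · rintro a b c (h1 | ⟨h1, g1⟩) (h2 | ⟨h2, g2⟩)
      · left; omega
      · left; omega
      · left; omega
      · right
        refine ⟨h1.trans h2, ?_⟩
        rw [← h1] at g2
        exact ltn_trans _ _ _ _ _ _ _ g1 g2
  · intro v hv
    left
    rw [SimpleGraph.dist_self]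
    exact hp.conn.pos_dist_of_ne hv.symm
  · intro w₁ w₂ v₁ v₂ hw a1 d1 a2 d2
    have c1 := hp.child a1 d1
    have c2 := hp.child a2 d2
    rcases hw with h | ⟨h, g⟩
    · left; omega
    · right
      refine ⟨by omega, ?_⟩
      rw [d1]
      left
      rw [c1.2, c2.2]; exact g
  · intro v u h
    apply opt_shift T hT f hf
    rcases h with h | ⟨h, g⟩
    · exact opt_level T hT f hf hp hmax _ v u rfl h
    · exact hmono _ v u rfl h.symm g

lemma Rt.deg {V : Type*} [Fintype V] [DecidableEq V] {T : SimpleGraph V} {v₀ : V} {p : V → V}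
    (h : Rt T v₀ p) (v : V) : gdeg T v =
      (Finset.univ.filter (fun w => w ≠ v₀ ∧ p w = v)).card + if v = v₀ then 0 else 1 := by
  have hN : T.neighborSet v = (((Finset.univ.filter (fun w => w ≠ v₀ ∧ p w = v)) ∪
      (if v = v₀ then ∅ else {p v}) : Finset V) : Set V) := by
    ext y
    simp only [mem_neighborSet, Finset.coe_union, Set.mem_union, Finset.mem_coe, Finset.mem_filter,
      Finset.mem_univ, true_and]
    constructor
    · intro ha
      rcases h.out v y ha with ⟨h1, h2⟩ | h1
      · right; simp [h1, h2]
      · left; exact h1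
    · rintro (⟨h1, h2⟩ | h1)
      · rw [← h2]; exact (h.adj y h1).symm
      · split_ifs at h1 with h3
        · simp at h1
        · rw [Finset.mem_singleton] at h1
          rw [h1]; exact h.adj v h3
  rw [gdeg, hN, Set.ncard_coe_finset, Finset.card_union_of_disjoint]
  · split_ifs <;> simp
  · rw [Finset.disjoint_left]
    intro y hy hy'
    simp only [Finset.mem_filter, Finset.mem_univ, true_and] at hy
    split_ifs at hy' with h3
    · simp at hy'
    · rw [Finset.mem_singleton] at hy'
      have e1 := h.dist y hy.1
      have e2 := h.dist v h3
      rw [hy.2] at e1; rw [← hy'] at e2; omega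

lemma bfd_data {V : Type*} [Fintype V] [DecidableEq V] (T : SimpleGraph V) (h : IsBFDTree T) :
    ∃ (e : V ≃ Fin (Fintype.card V)) (P : Fin (Fintype.card V) → Fin (Fintype.card V))
      (r : Fin (Fintype.card V)), (∀ i, r ≤ i) ∧
      (∀ i j, T.Adj (e.symm i) (e.symm j) ↔ (i ≠ r ∧ P i = j) ∨ (j ≠ r ∧ P j = i)) ∧
      (∀ i j, i ≠ r → j ≠ r → i < j → P i ≤ P j) ∧
      Antitone (fun i => gdeg T (e.symm i)) ∧
      (∀ i, gdeg T (e.symm i) = (Finset.univ.filter (fun j => j ≠ r ∧ P j = i)).card +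
        if i = r then 0 else 1) := by
  classical
  obtain ⟨hT, v₀, lt, hlt, hmin, hB1, hB2⟩ := h
  obtain ⟨p, hp⟩ := exists_rt T hT v₀
  let L : LinearOrder V := linearOrderOfSTO lt
  let e0 : Fin (Fintype.card V) ≃o V := @Fintype.orderIsoFinOfCardEq V L _ _ rfl
  let e : V ≃ Fin (Fintype.card V) := e0.symm.toEquiv
  have helt : ∀ i j, i < j → lt (e.symm i) (e.symm j) := by
    intro i j hij
    exact e0.lt_iff_lt.2 hij
  have hlt' : ∀ a b, lt a b → ¬ lt b a := fun a b h1 h2 => hlt.irrefl a (hlt.trans _ _ _ h1 h2)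
  refine ⟨e, fun i => e (p (e.symm i)), e v₀, ?_, ?_, ?_, ?_, ?_⟩
  · intro i
    by_contra hc
    push Not at hc
    have h1 := helt _ _ hc
    rw [Equiv.symm_apply_apply] at h1
    have h2 : e.symm i ≠ v₀ := by
      intro h0; rw [h0] at h1; exact hlt' _ _ h1 h1
    exact hlt' _ _ h1 (hmin _ h2)
  · intro i j
    have e1 : ∀ i, i ≠ e v₀ ↔ e.symm i ≠ v₀ := by
      intro i; rw [not_iff_not, Equiv.symm_apply_eq]
    have e2 : ∀ i j, e (p (e.symm i)) = j ↔ p (e.symm i) = e.symm j := by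
      intro i j; rw [Equiv.eq_symm_apply]
    rw [e1, e1, e2, e2]
    constructor
    · exact hp.out _ _
    · rintro (⟨h1, h2⟩ | ⟨h1, h2⟩)
      · rw [← h2]; exact hp.adj _ h1
      · rw [← h2]; exact (hp.adj _ h1).symm
  · intro i j hi hj hij
    by_contra hc
    push Not at hc
    have h1 := helt _ _ hc
    rw [Equiv.symm_apply_apply, Equiv.symm_apply_apply] at h1
    have e1 : ∀ i, i ≠ e v₀ → e.symm i ≠ v₀ := by
      intro i hi h0; apply hi; rw [← h0, Equiv.apply_symm_apply]
    exact hlt' _ _ (helt _ _ hij) (hB1 _ _ _ _ h1 (hp.adj _ (e1 j hj)).symm (hp.dist _ (e1 j hj))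
      (hp.adj _ (e1 i hi)).symm (hp.dist _ (e1 i hi)))
  · intro i j hij
    rcases hij.lt_or_eq with h | h
    · exact hB2 _ _ (helt _ _ h)
    · rw [h]
  · intro i
    rw [hp.deg]
    congr 1
    · apply Finset.card_equiv e
      intro a
      simp [Equiv.eq_symm_apply]
    · simp only [Equiv.symm_apply_eq]

lemma par_unique {n : ℕ} (r : Fin n) (P P' : Fin n → Fin n)
    (hm : ∀ i j, i ≠ r → j ≠ r → i < j → P i ≤ P j)
    (hm' : ∀ i j, i ≠ r → j ≠ r → i < j → P' i ≤ P' j)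
    (hc : ∀ i, (Finset.univ.filter (fun j => j ≠ r ∧ P j = i)).card =
      (Finset.univ.filter (fun j => j ≠ r ∧ P' j = i)).card) :
    ∀ j, j ≠ r → P j = P' j := by
  have aux : ∀ (P P' : Fin n → Fin n), 
    (∀ i j, i ≠ r → j ≠ r → i < j → P' i ≤ P' j) → 
    (∀ i, (Finset.univ.filter (fun j => j ≠ r ∧ P j = i)).card =
      (Finset.univ.filter (fun j => j ≠ r ∧ P' j = i)).card) → ∀ j, j ≠ r →
      (∀ k < j, k ≠ r → P k = P' k) → ¬ P j < P' j := by
    intro P P' hm' hc j hj ih hlt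
    have hss : (Finset.univ.filter (fun k => k ≠ r ∧ P' k = P j)) ⊂
        (Finset.univ.filter (fun k => k ≠ r ∧ P k = P j)) := by
      rw [Finset.ssubset_iff_of_subset]
      · refine ⟨j, by simp [hj], ?_⟩
        simp only [Finset.mem_filter, Finset.mem_univ, true_and, not_and]
        intro _ h; rw [h] at hlt; exact lt_irrefl _ hlt
      · intro k hk
        simp only [Finset.mem_filter, Finset.mem_univ, true_and] at hk ⊢
        refine ⟨hk.1, ?_⟩
        rcases lt_trichotomy k j with h | h | h
        · rw [ih k h hk.1, hk.2]
        · rw [h]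
        · have := hm' j k hj hk.1 h
          rw [hk.2] at this
          exact absurd hlt (not_lt.2 this)
    have := Finset.card_lt_card hss
    rw [hc] at this
    exact lt_irrefl _ this
  intro j
  induction j using WellFoundedLT.induction with
  | ind j ih =>
    intro hj
    rcases lt_trichotomy (P j) (P' j) with h | h | h
    · exact absurd h (aux P P' hm' hc j hj ih)
    · exact h
    · exact absurd h (aux P' P hm (fun i => (hc i).symm) j hj (fun k hk hkr => (ih k hk hkr).symm))

lemma bfd_iso {V : Type*} [Fintype V] [DecidableEq V] (T T' : SimpleGraph V) (h : IsBFDTree T)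
    (h' : IsBFDTree T') (hσ : ∃ σ : Equiv.Perm V, ∀ w, gdeg T' (σ w) = gdeg T w) :
    Nonempty (T ≃g T') := by
  obtain ⟨σ, hσ⟩ := hσ
  obtain ⟨e, P, r, hr, hadj, hm, hanti, hdeg⟩ := bfd_data T h
  obtain ⟨e', P', r', hr', hadj', hm', hanti', hdeg'⟩ := bfd_data T' h'
  obtain rfl : r = r' := le_antisymm (hr r') (hr' r)
  let τ : Equiv.Perm (Fin (Fintype.card V)) := e'.symm.trans (σ.symm.trans e)
  have hgg : ∀ i, gdeg T' (e'.symm i) = gdeg T (e.symm (τ i)) := by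
    intro i
    rw [← hσ]
    simp [τ]
  have key := Tuple.unique_monotone (f := fun i => OrderDual.toDual (gdeg T (e.symm i)))
    (σ := τ) (τ := Equiv.refl _)
    (by
      intro i j hij
      have := hanti' hij
      simp only [hgg] at this
      exact this)
    (by
      intro i j hij
      exact hanti hij)
  have hdd : ∀ i, gdeg T (e.symm i) = gdeg T' (e'.symm i) := by
    intro i
    rw [hgg]
    exact (congrArg OrderDual.ofDual (congrFun key i)).symm
  have hPP := par_unique r P P' hm hm' (by
    intro i
    have := hdd i
    rw [hdeg, hdeg'] at this
    omega)
  refine ⟨⟨e.trans e'.symm, ?_⟩⟩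
  intro a b
  have h1 := hadj (e a) (e b)
  rw [Equiv.symm_apply_apply, Equiv.symm_apply_apply] at h1
  rw [h1, Equiv.trans_apply, Equiv.trans_apply, hadj']
  constructor
  · rintro (⟨h1, h2⟩ | ⟨h1, h2⟩)
    · left; exact ⟨h1, by rw [hPP _ h1, h2]⟩
    · right; exact ⟨h1, by rw [hPP _ h1, h2]⟩
  · rintro (⟨h1, h2⟩ | ⟨h1, h2⟩)
    · left; exact ⟨h1, by rw [← hPP _ h1, h2]⟩
    · right; exact ⟨h1, by rw [← hPP _ h1, h2]⟩

lemma iso_gdeg {V : Type*} [Fintype V] [DecidableEq V] {T T' : SimpleGraph V} (φ : T ≃g T')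
    (w : V) : gdeg T' (φ w) = gdeg T w := by
  have : T'.neighborSet (φ w) = φ '' T.neighborSet w := by
    ext y
    obtain ⟨x, rfl⟩ := φ.surjective y
    simp [φ.map_adj_iff]
  rw [gdeg, this, Set.ncard_image_of_injective _ φ.injective, gdeg]

lemma iso_maxEig {V : Type*} [Fintype V] [DecidableEq V] {T T' : SimpleGraph V} (φ : T ≃g T')
    (lam : ℝ) (h : IsMaxEig T' lam) : IsMaxEig T lam := by
  classical
  have hL : ∀ {T T' : SimpleGraph V} (φ : T ≃g T') (g : V → ℝ) (v : V),
      (lap T *ᵥ (fun x => g (φ x))) v = (lap T' *ᵥ g) (φ v) := by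
    intro T T' φ g v
    rw [lap_apply, lap_apply]
    refine Eq.trans ?_ (Equiv.sum_comp φ.toEquiv _)
    apply Finset.sum_congr rfl
    intro y _
    have : T'.Adj (φ v) (φ.toEquiv y) ↔ T.Adj v y := φ.map_adj_iff
    by_cases h : T.Adj v y
    · rw [if_pos h, if_pos (this.2 h)]; rfl
    · rw [if_neg h, if_neg (fun hh => h (this.1 hh))]
  have hsub : ∀ {T T' : SimpleGraph V} (φ : T ≃g T') (μ : ℝ),
      (∃ f : V → ℝ, f ≠ 0 ∧ (lap T').mulVec f = μ • f) →
      (∃ f : V → ℝ, f ≠ 0 ∧ (lap T).mulVec f = μ • f) := by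
    rintro T T' φ μ ⟨f, hf, hfe⟩
    refine ⟨fun x => f (φ x), ?_, ?_⟩
    · intro h0
      apply hf
      funext y
      obtain ⟨x, rfl⟩ := φ.surjective y
      exact congrFun h0 x
    · funext v
      rw [hL φ, hfe]; rfl
  exact ⟨hsub φ lam h.1, fun μ hμ => h.2 (hsub φ.symm μ hμ)⟩

lemma exists_extremal {V : Type*} [Fintype V] [DecidableEq V] (T : SimpleGraph V)
    (hT : T.IsTree) : ∃ T' : SimpleGraph V, ExtremalTree T' ∧
      ∃ σ : Equiv.Perm V, ∀ w, gdeg T' (σ w) = gdeg T w := by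
  let X := {G : SimpleGraph V // G.IsTree ∧ ∃ σ : Equiv.Perm V, ∀ w, gdeg G (σ w) = gdeg T w}
  have : Nonempty X := ⟨⟨T, hT, Equiv.refl V, fun _ => rfl⟩⟩
  choose lam hlam _ using fun G : X => exists_maxEig G.1 G.2.1
  obtain ⟨G, hG⟩ := Finite.exists_max lam
  obtain ⟨σ, hσ⟩ := G.2.2
  refine ⟨G.1, ⟨G.2.1, lam G, hlam G, ?_⟩, σ, hσ⟩
  rintro T'' hT'' ⟨τ, hτ⟩ l hl
  let G'' : X := ⟨T'', hT'', σ.trans τ, fun w => by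
    rw [Equiv.trans_apply, hτ, hσ]⟩
  rw [hl.unique (hlam G'')]
  exact hG G''

/-- A tree with degree sequence `π` is extremal in `𝒯_π` iff it is a BFD-tree;
moreover, the extremal tree is unique up to isomorphism. -/
theorem stmt11 {V : Type*} [Fintype V] [DecidableEq V] (T : SimpleGraph V)
    (hT : T.IsTree) :
    (ExtremalTree T ↔ IsBFDTree T) ∧
    (∀ T' : SimpleGraph V, (∃ σ : Equiv.Perm V, ∀ w, gdeg T' (σ w) = gdeg T w) →
      ExtremalTree T → ExtremalTree T' → Nonempty (T ≃g T')) := by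
  have hEB : ∀ G : SimpleGraph V, ExtremalTree G → IsBFDTree G := by
    intro G hG
    obtain ⟨f, hf⟩ := ext_opt G hG
    exact opt_bfd G hG.1 f hf
  refine ⟨⟨hEB T, fun hB => ?_⟩, fun T' hσ h h' => bfd_iso T T' (hEB T h) (hEB T' h') hσ⟩
  obtain ⟨T', hT', hσ⟩ := exists_extremal T hT
  obtain ⟨φ⟩ := bfd_iso T T' hB (hEB T' hT') hσ
  obtain ⟨-, lam, hlam, hext⟩ := hT'
  refine ⟨hT, lam, iso_maxEig φ lam hlam, ?_⟩
  rintro T'' hT'' ⟨τ, hτ⟩ l hl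
  refine hext T'' hT'' ⟨φ.symm.toEquiv.trans τ, fun w => ?_⟩ l hl
  rw [Equiv.trans_apply, hτ]
  exact iso_gdeg φ.symm w
end

section
/- If T is extremal in 𝒯_π with eigenvector f for λ(T), then T admits a BFD-ordering ≺ that is consistent with f in the sense that |f(u)| > |f(v)| implies u ≺ v. -/
open SimpleGraph Finset Matrix

namespace BFD

open scoped Classical in
/-- Adjacency indicator. -/
noncomputable def e {V : Type*} (G : SimpleGraph V) (a b : V) : ℝ := if G.Adj a b then 1 else 0

lemma e_symm {V : Type*} (G : SimpleGraph V) (a b : V) : e G a b = e G b a := by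
  have h := G.adj_comm a b
  unfold e
  split_ifs <;> tauto

lemma e_nonneg {V : Type*} (G : SimpleGraph V) (a b : V) : 0 ≤ e G a b := by
  unfold e; split_ifs <;> norm_num

lemma gdeg_eq {V : Type*} [Fintype V] (G : SimpleGraph V) (a : V) :
    (gdeg G a : ℝ) = ∑ b, e G a b := by
  classical
  unfold gdeg e
  rw [Finset.sum_boole, Set.ncard_eq_toFinset_card']
  congr 2
  ext b; simp

lemma gdeg_eq_degree {V : Type*} [Fintype V] (G : SimpleGraph V) [DecidableRel G.Adj] (a : V) :
    gdeg G a = G.degree a := by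
  unfold gdeg
  rw [Set.ncard_eq_toFinset_card', SimpleGraph.degree, SimpleGraph.neighborFinset]

lemma lap_mulVec {V : Type*} [Fintype V] [DecidableEq V] (G : SimpleGraph V) (f : V → ℝ) (a : V) :
    (lap G).mulVec f a = ∑ b, e G a b * (f a - f b) := by
  simp only [Matrix.mulVec, dotProduct, lap, Matrix.of_apply, sub_mul, mul_sub,
    Finset.sum_sub_distrib, ← Finset.sum_mul, ← gdeg_eq]
  congr 1
  · simp

lemma lap_symm {V : Type*} [Fintype V] [DecidableEq V] (G : SimpleGraph V) :
    (lap G).IsHermitian := by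
  ext a b
  have hc := e_symm G a b
  unfold e at hc
  simp only [Matrix.conjTranspose_apply, lap, Matrix.of_apply, star_trivial, hc]
  by_cases h : a = b
  · subst h; rfl
  · simp [h, Ne.symm h]

/-- PSD kernel -/
lemma ker_of_max {V : Type*} [Fintype V] [DecidableEq V] (M : Matrix V V ℝ) (hM : M.IsHermitian)
    (μ : ℝ) (hmax : ∀ x : V → ℝ, x ⬝ᵥ M.mulVec x ≤ μ * (x ⬝ᵥ x)) (x : V → ℝ)
    (hx : x ⬝ᵥ M.mulVec x = μ * (x ⬝ᵥ x)) : M.mulVec x = μ • x := by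
  have key : ∀ y : V → ℝ, (μ • (1 : Matrix V V ℝ) - M).mulVec y = μ • y - M.mulVec y := by
    intro y
    rw [Matrix.sub_mulVec, Matrix.smul_mulVec, Matrix.one_mulVec]
  have hP : (μ • (1 : Matrix V V ℝ) - M).PosSemidef := by
    refine Matrix.PosSemidef.of_dotProduct_mulVec_nonneg ?_ ?_
    · refine Matrix.IsHermitian.sub ?_ hM
      simp [Matrix.IsHermitian]
    · intro y
      rw [key, dotProduct_sub, dotProduct_smul]
      have := hmax y
      simp only [star_trivial, smul_eq_mul]
      linarith
  have := (hP.dotProduct_mulVec_zero_iff x).1 (by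
    rw [key, dotProduct_sub, dotProduct_smul]
    simp only [star_trivial, smul_eq_mul]
    linarith)
  rw [key] at this
  exact (sub_eq_zero.1 this).symm

lemma exists_max {V : Type*} [Fintype V] [DecidableEq V] [Nonempty V] (M : Matrix V V ℝ)
    (hM : M.IsHermitian) : ∃ μ : ℝ, (∃ f : V → ℝ, f ≠ 0 ∧ M.mulVec f = μ • f) ∧
      ∀ x : V → ℝ, x ⬝ᵥ M.mulVec x ≤ μ * (x ⬝ᵥ x) := by
  have hc : IsCompact {x : V → ℝ | x ⬝ᵥ x = 1} := by
    refine Metric.isCompact_of_isClosed_isBounded ?_ ?_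
    · refine isClosed_eq ?_ continuous_const
      unfold dotProduct; fun_prop
    · refine (Metric.isBounded_closedBall (x := (0 : V → ℝ)) (r := 1)).subset ?_
      intro x hx
      rw [mem_closedBall_zero_iff, pi_norm_le_iff_of_nonneg zero_le_one]
      intro i
      have h1 : x i * x i ≤ x ⬝ᵥ x :=
        Finset.single_le_sum (f := fun i => x i * x i) (fun j _ => mul_self_nonneg _)
          (Finset.mem_univ i)
      rw [show x ⬝ᵥ x = 1 from hx] at h1
      rw [Real.norm_eq_abs, abs_le]
      constructor <;> nlinarith
  have hne : {x : V → ℝ | x ⬝ᵥ x = 1}.Nonempty := by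
    obtain ⟨i⟩ := ‹Nonempty V›
    exact ⟨Pi.single i 1, by simp⟩
  have hcont : ContinuousOn (fun x : V → ℝ => x ⬝ᵥ M.mulVec x) {x : V → ℝ | x ⬝ᵥ x = 1} := by
    apply Continuous.continuousOn
    unfold Matrix.mulVec dotProduct
    fun_prop
  obtain ⟨x0, hx0, hmax⟩ := hc.exists_isMaxOn hne hcont
  have hx0 : x0 ⬝ᵥ x0 = 1 := hx0
  have hall : ∀ x : V → ℝ, x ⬝ᵥ M.mulVec x ≤ (x0 ⬝ᵥ M.mulVec x0) * (x ⬝ᵥ x) := by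
    intro x
    by_cases hx : x = 0
    · simp [hx]
    · have hpos : 0 < x ⬝ᵥ x := by
        have h0 : 0 ≤ x ⬝ᵥ x := Finset.sum_nonneg fun j _ => mul_self_nonneg _
        refine lt_of_le_of_ne h0 fun h => hx (dotProduct_self_eq_zero.1 h.symm)
      set c := (Real.sqrt (x ⬝ᵥ x))⁻¹ with hcdef
      have hcc : c * c * (x ⬝ᵥ x) = 1 := by
        rw [hcdef, ← mul_inv, Real.mul_self_sqrt hpos.le]
        exact inv_mul_cancel₀ hpos.ne'
      have hmem : (c • x) ⬝ᵥ (c • x) = 1 := by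
        rw [smul_dotProduct, dotProduct_smul, smul_eq_mul, smul_eq_mul, ← mul_assoc, hcc]
      have h2 := hmax (show c • x ∈ {x : V → ℝ | x ⬝ᵥ x = 1} from hmem)
      simp only [Set.mem_ofPred_eq, Matrix.mulVec_smul, smul_dotProduct, dotProduct_smul,
        smul_eq_mul] at h2
      calc x ⬝ᵥ M.mulVec x = (c * (c * (x ⬝ᵥ M.mulVec x))) * (x ⬝ᵥ x) := by
            linear_combination (-(x ⬝ᵥ M.mulVec x)) * hcc
        _ ≤ _ := mul_le_mul_of_nonneg_right h2 hpos.le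
  refine ⟨x0 ⬝ᵥ M.mulVec x0, ⟨x0, ?_, ?_⟩, hall⟩
  · rintro rfl; simp at hx0
  · exact ker_of_max M hM _ hall x0 (by rw [hx0, mul_one])

/-- Signless Laplacian applied to `h`. -/
noncomputable def Q {V : Type*} [Fintype V] (G : SimpleGraph V) (h : V → ℝ) (a : V) : ℝ :=
  ∑ b, e G a b * (h a + h b)

lemma exists_sign {V : Type*} (G : SimpleGraph V) (hG : G.IsTree) :
    ∃ s : V → ℝ, (∀ a, s a * s a = 1) ∧ ∀ a b, G.Adj a b → s a = - s b := by
  obtain ⟨c⟩ := hG.colorable_two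
  refine ⟨fun a => if c a = 0 then 1 else -1, ?_, ?_⟩
  · intro a; dsimp; split_ifs <;> norm_num
  · intro a b hab
    have := c.valid hab
    have ha : c a = 0 ∨ c a = 1 := by omega
    have hb : c b = 0 ∨ c b = 1 := by omega
    rcases ha with ha | ha <;> rcases hb with hb | hb <;> simp_all

lemma Q_eq {V : Type*} [Fintype V] [DecidableEq V] (G : SimpleGraph V) (s : V → ℝ)
    (hs : ∀ a, s a * s a = 1) (hs' : ∀ a b, G.Adj a b → s a = - s b) (h : V → ℝ) (a : V) :
    Q G h a = s a * (lap G).mulVec (fun b => s b * h b) a := by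
  rw [lap_mulVec, Q, Finset.mul_sum]
  refine Finset.sum_congr rfl fun b _ => ?_
  by_cases hab : G.Adj a b
  · have h1 := hs' a b hab
    have h2 := hs a
    have h3 : s a * s b = -1 := by rw [h1] at h2; rw [h1]; linarith
    linear_combination (-(e G a b * h a)) * h2 + e G a b * h b * h3
  · simp [e, hab]

/-- The extremality package: for trees in the class. -/
lemma ext_pack {V : Type*} [Fintype V] [DecidableEq V] (G : SimpleGraph V) (hG : G.IsTree)
    (lam : ℝ) (hl : ∀ μ, IsMaxEig G μ → μ ≤ lam) :
    (∀ x : V → ℝ, x ⬝ᵥ (lap G).mulVec x ≤ lam * (x ⬝ᵥ x)) ∧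
    (∀ h : V → ℝ, ∑ a, h a * Q G h a ≤ lam * ∑ a, h a * h a) ∧
    (∀ h : V → ℝ, ∑ a, h a * Q G h a = lam * ∑ a, h a * h a → ∀ a, Q G h a = lam * h a) := by
  have : Nonempty V := hG.connected.nonempty
  obtain ⟨μ, hμ, hmax⟩ := exists_max (lap G) (lap_symm G)
  have hμl : μ ≤ lam := by
    refine hl μ ⟨hμ, ?_⟩
    rintro ν ⟨f, hf, hfe⟩
    have h1 := hmax f
    rw [hfe, dotProduct_smul, smul_eq_mul] at h1
    have h0 : 0 ≤ f ⬝ᵥ f := Finset.sum_nonneg fun j _ => mul_self_nonneg _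
    have hpos : 0 < f ⬝ᵥ f :=
      lt_of_le_of_ne h0 fun h => hf (dotProduct_self_eq_zero.1 h.symm)
    exact le_of_mul_le_mul_right h1 hpos
  have hA : ∀ x : V → ℝ, x ⬝ᵥ (lap G).mulVec x ≤ lam * (x ⬝ᵥ x) := fun x =>
    (hmax x).trans (mul_le_mul_of_nonneg_right hμl
      (Finset.sum_nonneg fun j _ => mul_self_nonneg _))
  obtain ⟨s, hs, hs'⟩ := exists_sign G hG
  have e1 : ∀ h : V → ℝ, ∑ a, h a * Q G h a
      = (fun b => s b * h b) ⬝ᵥ (lap G).mulVec (fun b => s b * h b) := by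
    intro h
    refine Finset.sum_congr rfl fun a _ => ?_
    rw [Q_eq G s hs hs']; ring
  have e2 : ∀ h : V → ℝ, ∑ a, h a * h a
      = (fun b => s b * h b) ⬝ᵥ (fun b => s b * h b) := by
    intro h
    refine Finset.sum_congr rfl fun a _ => ?_
    linear_combination (-(h a * h a)) * hs a
  refine ⟨hA, fun h => ?_, fun h hh a => ?_⟩
  · rw [e1, e2]; exact hA _
  · rw [e1, e2] at hh
    have := congrFun (ker_of_max (lap G) (lap_symm G) lam hA _ hh) a
    rw [Q_eq G s hs hs', this]
    simp only [Pi.smul_apply, smul_eq_mul]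
    linear_combination (lam * h a) * hs a

/-- `|f|` is a positive eigenvector of the signless Laplacian. -/
lemma abs_eig {V : Type*} [Fintype V] [DecidableEq V] (G : SimpleGraph V) (hG : G.IsTree)
    (lam : ℝ) (hl : ∀ μ, IsMaxEig G μ → μ ≤ lam) (f : V → ℝ) (hf : f ≠ 0)
    (hef : (lap G).mulVec f = lam • f) :
    (∀ a, Q G (fun v => |f v|) a = lam * |f a|) ∧ ∀ a, 0 < |f a| := by
  obtain ⟨hA, hB, hC⟩ := ext_pack G hG lam hl
  have h1 : lam * ∑ a, |f a| * |f a| ≤ ∑ a, |f a| * Q G (fun v => |f v|) a := by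
    have h2 : ∑ a, f a * (lap G).mulVec f a = lam * ∑ a, |f a| * |f a| := by
      rw [hef, Finset.mul_sum]
      refine Finset.sum_congr rfl fun a _ => ?_
      simp only [Pi.smul_apply, smul_eq_mul, abs_mul_abs_self]; ring
    rw [← h2]
    refine (Finset.sum_le_sum (f := fun a => f a * (lap G).mulVec f a)
      (g := fun a => |f a| * Q G (fun v => |f v|) a) fun a _ => ?_)
    rw [lap_mulVec, Q, Finset.mul_sum, Finset.mul_sum]
    refine Finset.sum_le_sum fun b _ => ?_
    have h3 : -(f a * f b) ≤ |f a| * |f b| := by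
      rw [← abs_mul]; exact neg_le_abs _
    have h4 := abs_mul_abs_self (f a)
    have h5 : f a * (f a - f b) ≤ |f a| * (|f a| + |f b|) := by nlinarith
    calc f a * (e G a b * (f a - f b)) = e G a b * (f a * (f a - f b)) := by ring
      _ ≤ e G a b * (|f a| * (|f a| + |f b|)) := mul_le_mul_of_nonneg_left h5 (e_nonneg _ _ _)
      _ = _ := by ring
  have hE := hC (fun v => |f v|) (le_antisymm (hB _) h1)
  refine ⟨hE, ?_⟩
  by_contra hcon
  push Not at hcon
  obtain ⟨a, ha⟩ := hcon
  have ha : f a = 0 := abs_nonpos_iff.1 ha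
  have step : ∀ u v, G.Adj u v → f u = 0 → f v = 0 := by
    intro u v huv hu
    have h6 := hE u
    simp only [hu, abs_zero, mul_zero, Q, zero_add] at h6
    rw [Finset.sum_eq_zero_iff_of_nonneg
      (fun b _ => mul_nonneg (e_nonneg _ _ _) (abs_nonneg _))] at h6
    have h7 := h6 v (Finset.mem_univ _)
    simpa [e, huv] using h7
  apply hf
  funext v
  obtain ⟨p⟩ := hG.connected a v
  have : ∀ (x y : V) (p : G.Walk x y), f x = 0 → f y = 0 := by
    intro x y p
    induction p with
    | nil => exact id
    | cons hadj _ ih => exact fun hx => ih (step _ _ hadj hx)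
  exact this _ _ p ha

/-- Each vertex of `S` exchanges its adjacencies to `w₁` and `w₂`. -/
def sw {V : Type*} [DecidableEq V] (T : SimpleGraph V) (S : Finset V) (w₁ w₂ : V) :
    SimpleGraph V where
  Adj a b := if a ∈ S ∨ b ∈ S then T.Adj (Equiv.swap w₁ w₂ a) (Equiv.swap w₁ w₂ b) else T.Adj a b
  symm := ⟨by
    intro a b h
    by_cases hS : a ∈ S ∨ b ∈ S
    · rw [if_pos hS] at h; rw [if_pos hS.symm]; exact h.symm
    · rw [if_neg hS] at h; rw [if_neg (fun h => hS h.symm)]; exact h.symm⟩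
  loopless := ⟨by
    intro a h
    split_ifs at h
    · exact T.loopless.irrefl _ h
    · exact T.loopless.irrefl _ h⟩

/-- Subgraph of edges avoiding `S`. -/
def av {V : Type*} (T : SimpleGraph V) (S : Finset V) : SimpleGraph V where
  Adj a b := T.Adj a b ∧ a ∉ S ∧ b ∉ S
  symm := ⟨fun _ _ h => ⟨h.1.symm, h.2.2, h.2.1⟩⟩
  loopless := ⟨fun _ h => T.loopless.irrefl _ h.1⟩

lemma e_congr {V : Type*} {G G' : SimpleGraph V} {a b c d : V} (h : G.Adj a b ↔ G'.Adj c d) :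
    e G a b = e G' c d := by
  unfold e
  split_ifs <;> tauto

section swap
variable {V : Type*} [Fintype V] [DecidableEq V] (T : SimpleGraph V) (S : Finset V) (w₁ w₂ : V)

lemma e_sw_mem (h1 : w₁ ∉ S) (h2 : w₂ ∉ S) {a : V} (ha : a ∈ S) (b : V) :
    e (sw T S w₁ w₂) a b = e T a (Equiv.swap w₁ w₂ b) := by
  have : Equiv.swap w₁ w₂ a = a :=
    Equiv.swap_apply_of_ne_of_ne (fun h => h1 (h ▸ ha)) (fun h => h2 (h ▸ ha))
  exact e_congr (by simp only [sw, ha, true_or, if_true, this])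

lemma e_sw_other (h1 : w₁ ∉ S) (h2 : w₂ ∉ S) {a : V} (ha : a ∉ S) (ha1 : a ≠ w₁) (ha2 : a ≠ w₂)
    (b : V) : e (sw T S w₁ w₂) a b = e T a b := by
  have h3 : Equiv.swap w₁ w₂ a = a := Equiv.swap_apply_of_ne_of_ne ha1 ha2
  by_cases hb : b ∈ S
  · have : Equiv.swap w₁ w₂ b = b :=
      Equiv.swap_apply_of_ne_of_ne (fun h => h1 (h ▸ hb)) (fun h => h2 (h ▸ hb))
    exact e_congr (by simp only [sw, hb, or_true, if_true, this, h3])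
  · exact e_congr (by simp only [sw, hb, ha, or_false, if_false])

lemma e_sw_left (h1 : w₁ ∉ S) (h2 : w₂ ∉ S) (b : V) :
    e (sw T S w₁ w₂) w₁ b = if b ∈ S then e T w₂ b else e T w₁ b := by
  by_cases hb : b ∈ S
  · have : Equiv.swap w₁ w₂ b = b :=
      Equiv.swap_apply_of_ne_of_ne (fun h => h1 (h ▸ hb)) (fun h => h2 (h ▸ hb))
    rw [if_pos hb]
    exact e_congr (by simp only [sw, hb, or_true, if_true, this, Equiv.swap_apply_left])
  · rw [if_neg hb]
    exact e_congr (by simp only [sw, hb, h1, or_false, if_false])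

lemma sw_comm : sw T S w₁ w₂ = sw T S w₂ w₁ := by
  ext a b; simp only [sw, Equiv.swap_comm w₁ w₂]

lemma sum_left (h1 : w₁ ∉ S) (h2 : w₂ ∉ S) (g : V → ℝ) :
    ∑ b, e (sw T S w₁ w₂) w₁ b * g b
      = ∑ b, e T w₁ b * g b + ∑ b ∈ S, (e T w₂ b - e T w₁ b) * g b := by
  rw [← Finset.sum_filter_add_sum_filter_not univ (· ∈ S) (fun b => e T w₁ b * g b),
    ← Finset.sum_filter_add_sum_filter_not univ (· ∈ S)
      (fun b => e (sw T S w₁ w₂) w₁ b * g b)]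
  have hS : univ.filter (· ∈ S) = S := by ext; simp
  rw [hS]
  have h3 : ∑ b ∈ S, e (sw T S w₁ w₂) w₁ b * g b = ∑ b ∈ S, e T w₂ b * g b :=
    Finset.sum_congr rfl fun b hb => by rw [e_sw_left T S w₁ w₂ h1 h2, if_pos hb]
  have h4 : ∑ b ∈ univ.filter (¬ · ∈ S), e (sw T S w₁ w₂) w₁ b * g b
      = ∑ b ∈ univ.filter (¬ · ∈ S), e T w₁ b * g b :=
    Finset.sum_congr rfl fun b hb => by
      rw [e_sw_left T S w₁ w₂ h1 h2, if_neg (by simpa using hb)]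
  rw [h3, h4]
  simp only [sub_mul, Finset.sum_sub_distrib]
  ring

lemma sum_right (h1 : w₁ ∉ S) (h2 : w₂ ∉ S) (g : V → ℝ) :
    ∑ b, e (sw T S w₁ w₂) w₂ b * g b
      = ∑ b, e T w₂ b * g b + ∑ b ∈ S, (e T w₁ b - e T w₂ b) * g b := by
  rw [sw_comm]; exact sum_left T S w₂ w₁ h2 h1 g

lemma sum_mem (h1 : w₁ ∉ S) (h2 : w₂ ∉ S) (hw : w₁ ≠ w₂) {a : V} (ha : a ∈ S) (g : V → ℝ) :
    ∑ b, e (sw T S w₁ w₂) a b * g b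
      = ∑ b, e T a b * g b + (e T w₂ a - e T w₁ a) * (g w₁ - g w₂) := by
  have h3 : ∑ b, (e (sw T S w₁ w₂) a b * g b - e T a b * g b)
      = ∑ b ∈ ({w₁, w₂} : Finset V), (e (sw T S w₁ w₂) a b * g b - e T a b * g b) := by
    symm
    refine Finset.sum_subset (Finset.subset_univ _) fun b _ hb => ?_
    simp only [Finset.mem_insert, Finset.mem_singleton, not_or] at hb
    rw [e_sw_mem T S w₁ w₂ h1 h2 ha, Equiv.swap_apply_of_ne_of_ne hb.1 hb.2, sub_self]
  rw [Finset.sum_sub_distrib, Finset.sum_pair hw] at h3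
  rw [e_sw_mem T S w₁ w₂ h1 h2 ha, e_sw_mem T S w₁ w₂ h1 h2 ha, Equiv.swap_apply_left,
    Equiv.swap_apply_right] at h3
  rw [e_symm T w₂ a, e_symm T w₁ a]
  linarith

lemma gdeg_other (h1 : w₁ ∉ S) (h2 : w₂ ∉ S) (hw : w₁ ≠ w₂) {a : V} (ha1 : a ≠ w₁) (ha2 : a ≠ w₂) :
    gdeg (sw T S w₁ w₂) a = gdeg T a := by
  have : (gdeg (sw T S w₁ w₂) a : ℝ) = gdeg T a := by
    rw [gdeg_eq, gdeg_eq]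
    by_cases ha : a ∈ S
    · have := sum_mem T S w₁ w₂ h1 h2 hw ha (fun _ => 1)
      simpa using this
    · exact Finset.sum_congr rfl fun b _ => e_sw_other T S w₁ w₂ h1 h2 ha ha1 ha2 b
  exact_mod_cast this

lemma gdeg_left (h1 : w₁ ∉ S) (h2 : w₂ ∉ S) :
    (gdeg (sw T S w₁ w₂) w₁ : ℝ) = gdeg T w₁ + ∑ b ∈ S, (e T w₂ b - e T w₁ b) := by
  rw [gdeg_eq, gdeg_eq]
  simpa using sum_left T S w₁ w₂ h1 h2 (fun _ => 1)

lemma gdeg_right (h1 : w₁ ∉ S) (h2 : w₂ ∉ S) :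
    (gdeg (sw T S w₁ w₂) w₂ : ℝ) = gdeg T w₂ + ∑ b ∈ S, (e T w₁ b - e T w₂ b) := by
  rw [gdeg_eq, gdeg_eq]
  simpa using sum_right T S w₁ w₂ h1 h2 (fun _ => 1)

/-- change of the quadratic form -/
lemma quad_diff (h1 : w₁ ∉ S) (h2 : w₂ ∉ S) (hw : w₁ ≠ w₂) (h : V → ℝ) :
    ∑ a, h a * Q (sw T S w₁ w₂) h a = ∑ a, h a * Q T h a
      + ∑ b ∈ S, (e T w₂ b - e T w₁ b) * ((h b + h w₁) ^ 2 - (h b + h w₂) ^ 2) := by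
  have hd : ∀ a, h a * Q (sw T S w₁ w₂) h a = h a * Q T h a
      + ((if a ∈ S then h a * ((e T w₂ a - e T w₁ a) * (h w₁ - h w₂)) else 0)
      + (if a = w₁ then h w₁ * ∑ b ∈ S, (e T w₂ b - e T w₁ b) * (h w₁ + h b) else 0)
      + (if a = w₂ then h w₂ * ∑ b ∈ S, (e T w₁ b - e T w₂ b) * (h w₂ + h b) else 0)) := by
    intro a
    unfold Q
    by_cases ha1 : a = w₁
    · subst ha1
      rw [sum_left T S a w₂ h1 h2]
      simp [h1, hw, mul_add]
    by_cases ha2 : a = w₂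
    · subst ha2
      rw [sum_right T S w₁ a h1 h2]
      simp [h2, hw.symm, mul_add]
    by_cases ha : a ∈ S
    · rw [sum_mem T S w₁ w₂ h1 h2 hw ha]
      simp [ha, ha1, ha2, mul_add]
    · simp only [ha, ha1, ha2, if_false, add_zero]
      congr 1
      exact Finset.sum_congr rfl fun b _ => by rw [e_sw_other T S w₁ w₂ h1 h2 ha ha1 ha2 b]
  simp only [hd, Finset.sum_add_distrib]
  simp only [Finset.sum_ite_eq', Finset.mem_univ, if_true, Finset.sum_ite_mem, Finset.univ_inter,
    Finset.mul_sum]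
  rw [← Finset.sum_add_distrib, ← Finset.sum_add_distrib]
  congr 1
  exact Finset.sum_congr rfl fun b _ => by ring

lemma av_le : av T S ≤ sw T S w₁ w₂ := by
  intro a b h
  simp only [sw, h.2.1, h.2.2, or_false, if_false]
  exact h.1

lemma sw_connected (hT : T.Connected) (h1 : w₁ ∉ S) (h2 : w₂ ∉ S)
    (hr : (av T S).Reachable w₁ w₂) : (sw T S w₁ w₂).Connected := by
  have hr' : (sw T S w₁ w₂).Reachable w₁ w₂ := hr.mono (av_le T S w₁ w₂)
  have hmem : ∀ a b, T.Adj a b → a ∈ S → (sw T S w₁ w₂).Reachable a b := by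
    intro a b hab ha
    have h3 : Equiv.swap w₁ w₂ a = a :=
      Equiv.swap_apply_of_ne_of_ne (fun h => h1 (h ▸ ha)) (fun h => h2 (h ▸ ha))
    have h4 : (sw T S w₁ w₂).Adj a (Equiv.swap w₁ w₂ b) := by
      simp only [sw, ha, true_or, if_true, Equiv.swap_apply_self, h3]; exact hab
    refine h4.reachable.trans ?_
    by_cases hb1 : b = w₁
    · subst hb1; rw [Equiv.swap_apply_left]; exact hr'.symm
    by_cases hb2 : b = w₂
    · subst hb2; rw [Equiv.swap_apply_right]; exact hr'
    rw [Equiv.swap_apply_of_ne_of_ne hb1 hb2]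
  have hadj : ∀ a b, T.Adj a b → (sw T S w₁ w₂).Reachable a b := by
    intro a b hab
    by_cases ha : a ∈ S
    · exact hmem a b hab ha
    by_cases hb : b ∈ S
    · exact (hmem b a hab.symm hb).symm
    exact (SimpleGraph.Adj.reachable (av_le T S w₁ w₂ ⟨hab, ha, hb⟩))
  have hw : ∀ (x y : V) (p : T.Walk x y), (sw T S w₁ w₂).Reachable x y := by
    intro x y p
    induction p with
    | nil => exact SimpleGraph.Reachable.refl _
    | cons h _ ih => exact (hadj _ _ h).trans ih
  have := hT.nonempty
  refine ⟨fun x y => ?_⟩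
  obtain ⟨p⟩ := hT x y
  exact hw x y p

end swap

lemma isTree_of_perm {V : Type*} [Fintype V] [DecidableEq V] (T T' : SimpleGraph V)
    (hT : T.IsTree) (hc : T'.Connected) (σ : Equiv.Perm V) (hσ : ∀ w, gdeg T' (σ w) = gdeg T w) :
    T'.IsTree := by
  classical
  rw [SimpleGraph.isTree_iff_connected_and_card] at hT ⊢
  refine ⟨hc, ?_⟩
  rw [← hT.2]
  have h1 := T.sum_degrees_eq_twice_card_edges
  have h2 := T'.sum_degrees_eq_twice_card_edges
  have h3 : ∑ v, T'.degree v = ∑ v, T.degree v := by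
    rw [← Equiv.sum_comp σ]
    refine Finset.sum_congr rfl fun v _ => ?_
    rw [← gdeg_eq_degree, ← gdeg_eq_degree, hσ]
  rw [Nat.card_eq_fintype_card, Nat.card_eq_fintype_card, ← SimpleGraph.edgeFinset_card,
    ← SimpleGraph.edgeFinset_card]
  omega

/-- Extremality: data for `T` and the positive vector `h`. -/
def Extr {V : Type*} [Fintype V] [DecidableEq V] (T : SimpleGraph V) (lam : ℝ) (h : V → ℝ) :
    Prop :=
  T.IsTree ∧ (∀ a, Q T h a = lam * h a) ∧ (∀ a, 0 < h a) ∧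
  ∀ T' : SimpleGraph V, T'.Connected → (∃ σ : Equiv.Perm V, ∀ w, gdeg T' (σ w) = gdeg T w) →
    ∑ a, h a * Q T' h a ≤ ∑ a, h a * Q T h a ∧
    (∑ a, h a * Q T' h a = ∑ a, h a * Q T h a → ∀ a, Q T' h a = Q T h a)

lemma extr_of {V : Type*} [Fintype V] [DecidableEq V] (T : SimpleGraph V)
    (hT : T.IsTree) (lam : ℝ)
    (hext : ∀ T'' : SimpleGraph V, T''.IsTree →
      (∃ σ : Equiv.Perm V, ∀ w, gdeg T'' (σ w) = gdeg T w) →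
      ∀ lam'' : ℝ, IsMaxEig T'' lam'' → lam'' ≤ lam)
    (f : V → ℝ) (hf : f ≠ 0) (hef : (lap T).mulVec f = lam • f) :
    Extr T lam (fun v => |f v|) := by
  obtain ⟨hA, hB⟩ := abs_eig T hT lam (hext T hT ⟨Equiv.refl _, fun _ => rfl⟩) f hf hef
  refine ⟨hT, hA, hB, ?_⟩
  rintro T' hc ⟨σ, hσ⟩
  have hT' := isTree_of_perm T T' hT hc σ hσ
  obtain ⟨-, h1, h2⟩ := ext_pack T' hT' lam (hext T' hT' ⟨σ, hσ⟩)
  have h3 : ∑ a, |f a| * Q T (fun v => |f v|) a = lam * ∑ a, |f a| * |f a| := by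
    rw [Finset.mul_sum]
    refine Finset.sum_congr rfl fun a _ => ?_
    rw [hA]; ring
  rw [h3]
  exact ⟨h1 _, fun h a => by rw [h2 _ h a, hA]⟩

/-- Switching lemma. -/
lemma switch {V : Type*} [Fintype V] [DecidableEq V] {T : SimpleGraph V} {lam : ℝ} {h : V → ℝ}
    (hE : Extr T lam h) {w₁ w₂ v₁ v₂ : V} (hw : w₁ ≠ w₂) (hv : v₁ ≠ v₂)
    (h11 : T.Adj w₁ v₁) (h22 : T.Adj w₂ v₂) (h12 : ¬ T.Adj w₁ v₂) (h21 : ¬ T.Adj w₂ v₁)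
    (n12 : w₁ ≠ v₂) (n21 : w₂ ≠ v₁)
    (hr : (av T {v₁, v₂}).Reachable w₁ w₂) :
    (h w₁ < h w₂ → h v₁ < h v₂) ∧ (h w₁ = h w₂ → h v₁ = h v₂) := by
  obtain ⟨hT, -, -, hext⟩ := hE
  set S : Finset V := {v₁, v₂} with hS
  have m1 : w₁ ∉ S := by simp [hS, h11.ne, n12]
  have m2 : w₂ ∉ S := by simp [hS, h22.ne, n21]
  have e11 : e T w₁ v₁ = 1 := by simp [e, h11]
  have e22 : e T w₂ v₂ = 1 := by simp [e, h22]
  have e12 : e T w₁ v₂ = 0 := by simp [e, h12]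
  have e21 : e T w₂ v₁ = 0 := by simp [e, h21]
  have hdeg : ∀ a, gdeg (sw T S w₁ w₂) a = gdeg T a := by
    intro a
    by_cases ha1 : a = w₁
    · have := gdeg_left T S w₁ w₂ m1 m2
      rw [hS, Finset.sum_pair hv, e11, e12, e21, e22] at this
      rw [ha1]
      norm_num at this
      exact_mod_cast this
    by_cases ha2 : a = w₂
    · have := gdeg_right T S w₁ w₂ m1 m2
      rw [hS, Finset.sum_pair hv, e11, e12, e21, e22] at this
      rw [ha2]
      norm_num at this
      exact_mod_cast this
    exact gdeg_other T S w₁ w₂ m1 m2 hw ha1 ha2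
  obtain ⟨hle, heq⟩ := hext (sw T S w₁ w₂) (sw_connected T S w₁ w₂ hT.connected m1 m2 hr)
    ⟨Equiv.refl _, hdeg⟩
  have hq := quad_diff T S w₁ w₂ m1 m2 hw h
  rw [hS, Finset.sum_pair hv, e11, e12, e21, e22, ← hS] at hq
  have hq' : ∑ a, h a * Q (sw T S w₁ w₂) h a = ∑ a, h a * Q T h a
      + 2 * ((h w₁ - h w₂) * (h v₂ - h v₁)) := by rw [hq]; ring
  have hprod : (h w₁ - h w₂) * (h v₂ - h v₁) ≤ 0 := by linarith
  have hz : (h w₁ - h w₂) * (h v₂ - h v₁) = 0 → h v₁ = h v₂ ∧ h w₁ = h w₂ := by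
    intro h0
    rw [h0] at hq'
    have hQ := heq (by linarith)
    constructor
    · have h3 := hQ w₁
      unfold Q at h3
      rw [sum_left T S w₁ w₂ m1 m2, hS, Finset.sum_pair hv, e11, e12, e21, e22] at h3
      linarith
    · have h3 := hQ v₁
      unfold Q at h3
      rw [sum_mem T S w₁ w₂ m1 m2 hw (by simp [hS]), e11, e21] at h3
      linarith
  constructor
  · intro hlt
    by_contra hcon
    push Not at hcon
    have h4 : (h w₁ - h w₂) * (h v₂ - h v₁) = 0 := le_antisymm hprod (by nlinarith)
    have := (hz h4).2
    linarith
  · intro he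
    exact (hz (by rw [he]; ring)).1

/-- Shifting lemma. -/
lemma shift {V : Type*} [Fintype V] [DecidableEq V] {T : SimpleGraph V} {lam : ℝ} {h : V → ℝ}
    (hE : Extr T lam h) {w₁ w₂ : V} (hw : w₁ ≠ w₂) (S : Finset V) (hSn : S.Nonempty)
    (h1 : ∀ x ∈ S, T.Adj w₁ x) (h2 : ∀ x ∈ S, ¬ T.Adj w₂ x) (m2 : w₂ ∉ S)
    (hcard : gdeg T w₁ = gdeg T w₂ + S.card)
    (hr : (av T S).Reachable w₁ w₂) : h w₂ < h w₁ := by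
  obtain ⟨hT, -, hpos, hext⟩ := hE
  have m1 : w₁ ∉ S := fun hm => (h1 _ hm).ne rfl
  have e1 : ∀ b ∈ S, e T w₁ b = 1 := fun b hb => by simp [e, h1 b hb]
  have e2 : ∀ b ∈ S, e T w₂ b = 0 := fun b hb => by simp [e, h2 b hb]
  have d1 : gdeg (sw T S w₁ w₂) w₁ = gdeg T w₂ := by
    have := gdeg_left T S w₁ w₂ m1 m2
    rw [Finset.sum_congr rfl (fun b hb => by rw [e1 b hb, e2 b hb])] at this
    rw [hcard] at this
    push_cast at this
    simp at this
    exact_mod_cast this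
  have d2 : gdeg (sw T S w₁ w₂) w₂ = gdeg T w₁ := by
    have := gdeg_right T S w₁ w₂ m1 m2
    rw [Finset.sum_congr rfl (fun b hb => by rw [e1 b hb, e2 b hb])] at this
    rw [hcard]
    simp at this
    exact_mod_cast this
  obtain ⟨hle, heq⟩ := hext (sw T S w₁ w₂) (sw_connected T S w₁ w₂ hT.connected m1 m2 hr)
    ⟨Equiv.swap w₁ w₂, by
      intro a
      by_cases ha1 : a = w₁
      · rw [ha1, Equiv.swap_apply_left, d2]
      by_cases ha2 : a = w₂
      · rw [ha2, Equiv.swap_apply_right, d1]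
      rw [Equiv.swap_apply_of_ne_of_ne ha1 ha2]
      exact gdeg_other T S w₁ w₂ m1 m2 hw ha1 ha2⟩
  by_contra hcon
  push Not at hcon
  have hq := quad_diff T S w₁ w₂ m1 m2 hw h
  have hnn : 0 ≤ ∑ b ∈ S, (e T w₂ b - e T w₁ b) * ((h b + h w₁) ^ 2 - (h b + h w₂) ^ 2) := by
    refine Finset.sum_nonneg fun b hb => ?_
    rw [e1 b hb, e2 b hb]
    nlinarith [hpos b, hpos w₁, hpos w₂]
  have h3 := heq (by linarith) w₂
  unfold Q at h3
  rw [sum_right T S w₁ w₂ m1 m2] at h3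
  have : 0 < ∑ b ∈ S, (e T w₁ b - e T w₂ b) * (h w₂ + h b) := by
    refine Finset.sum_pos (fun b hb => ?_) hSn
    rw [e1 b hb, e2 b hb]
    linarith [hpos b, hpos w₂]
  linarith

/-- parent function of the tree rooted at `r` -/
def IsPar {V : Type*} (T : SimpleGraph V) (r : V) (par : V → V) : Prop :=
  par r = r ∧ (∀ v, v ≠ r → T.Adj v (par v) ∧ T.dist r v = T.dist r (par v) + 1) ∧
  (∀ w v, T.Adj w v → T.dist r v = T.dist r w + 1 → par v = w) ∧
  (∀ w v, T.Adj w v → T.dist r v = T.dist r w + 1 ∨ T.dist r w = T.dist r v + 1) ∧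
  (∀ v, T.dist r v = 0 → v = r)

lemma exists_par {V : Type*} (T : SimpleGraph V) (hT : T.IsTree) (r : V) :
    ∃ par, IsPar T r par := by
  classical
  have h4 : ∀ w v, T.Adj w v → T.dist r v = T.dist r w + 1 ∨ T.dist r w = T.dist r v + 1 :=
    fun w v hwv => (hT.dist_eq_dist_add_one_of_adj r hwv).symm
  have h5 : ∀ v, T.dist r v = 0 → v = r := fun v hv =>
    (hT.connected.dist_eq_zero_iff.1 hv).symm
  have hex : ∀ v, v ≠ r → ∃ w, T.Adj v w ∧ T.dist r v = T.dist r w + 1 := by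
    intro v hv
    obtain ⟨p, hp⟩ := hT.connected.exists_walk_length_eq_dist v r
    cases p with
    | nil => exact absurd rfl hv
    | @cons _ w _ hadj q =>
      refine ⟨w, hadj, ?_⟩
      have h1 : T.dist w r ≤ q.length := SimpleGraph.dist_le q
      rw [SimpleGraph.Walk.length_cons] at hp
      rcases h4 v w hadj with h | h
      · rw [SimpleGraph.dist_comm (u := r) (v := w), SimpleGraph.dist_comm (u := r) (v := v)] at h
        omega
      · exact h
  have huniq : ∀ w w' v, T.Adj w v → T.dist r v = T.dist r w + 1 → T.Adj w' v →
      T.dist r v = T.dist r w' + 1 → w = w' := by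
    intro w w' v h1 h2 h3 h6
    obtain ⟨p, hp⟩ := hT.connected.exists_walk_length_eq_dist r w
    obtain ⟨q, hq⟩ := hT.connected.exists_walk_length_eq_dist r w'
    have hp' : (p.concat h1).IsPath :=
      SimpleGraph.Walk.isPath_of_length_eq_dist _ (by
        rw [SimpleGraph.Walk.length_concat, hp, h2])
    have hq' : (q.concat h3).IsPath :=
      SimpleGraph.Walk.isPath_of_length_eq_dist _ (by
        rw [SimpleGraph.Walk.length_concat, hq, h6])
    have := (hT.existsUnique_path r v).unique hp' hq'
    have := congrArg SimpleGraph.Walk.penultimate this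
    simpa using this
  refine ⟨fun v => if h : v = r then r else (hex v h).choose, by simp, ?_, ?_, h4, h5⟩
  · intro v hv
    simp only [hv, dite_false]
    exact (hex v hv).choose_spec
  · intro w v hwv hd
    have hv : v ≠ r := by
      rintro rfl
      rw [SimpleGraph.dist_self] at hd; omega
    simp only [hv, dite_false]
    obtain ⟨h1, h2⟩ := (hex v hv).choose_spec
    exact huniq _ _ v h1.symm h2 hwv hd

lemma IsPar.depth_par {V : Type*} {T : SimpleGraph V} {r : V} {par : V → V} (hP : IsPar T r par)
    (v : V) : T.dist r (par v) = T.dist r v - 1 := by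
  by_cases hv : v = r
  · rw [hv, hP.1, SimpleGraph.dist_self]
  · have := (hP.2.1 v hv).2; omega

lemma IsPar.depth_iter {V : Type*} {T : SimpleGraph V} {r : V} {par : V → V} (hP : IsPar T r par)
    (v : V) (k : ℕ) : T.dist r (par^[k] v) = T.dist r v - k := by
  induction k with
  | zero => rfl
  | succ k ih => rw [Function.iterate_succ_apply', hP.depth_par, ih]; omega

lemma IsPar.iter_root {V : Type*} {T : SimpleGraph V} {r : V} {par : V → V} (hP : IsPar T r par)
    (v : V) : par^[T.dist r v] v = r :=
  hP.2.2.2.2 _ (by rw [hP.depth_iter]; omega)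

lemma IsPar.chain {V : Type*} {T : SimpleGraph V} {r : V} {par : V → V} (hP : IsPar T r par)
    (S : Finset V) (v : V) (k : ℕ) (hS : ∀ j ≤ k, par^[j] v ∉ S) :
    (av T S).Reachable v (par^[k] v) := by
  induction k with
  | zero => exact SimpleGraph.Reachable.refl _
  | succ k ih =>
    refine (ih fun j hj => hS j (by omega)).trans ?_
    have h1 := hS k (by omega)
    have h2 := hS (k + 1) le_rfl
    rw [Function.iterate_succ_apply'] at h2 ⊢
    by_cases hv : par^[k] v = r
    · rw [hv, hP.1]
    · exact SimpleGraph.Adj.reachable ⟨(hP.2.1 _ hv).1, h1, h2⟩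

/-- (B2) -/
lemma deg_mono {V : Type*} [Fintype V] [DecidableEq V] {T : SimpleGraph V} {lam : ℝ} {h : V → ℝ}
    (hE : Extr T lam h) {u v : V} (huv : h u ≤ h v) : gdeg T u ≤ gdeg T v := by
  classical
  by_contra hcon
  push Not at hcon
  have hT := hE.1
  have hne : u ≠ v := by rintro rfl; omega
  obtain ⟨par, hP⟩ := exists_par T hT v
  have hpos : 0 < gdeg T v := by
    rw [gdeg_eq_degree]
    exact (hT.connected u v).degree_pos_right hne
  have hcard : gdeg T u - gdeg T v ≤ ((T.neighborFinset u).erase (par u)).card := by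
    have := Finset.pred_card_le_card_erase (s := T.neighborFinset u) (a := par u)
    rw [SimpleGraph.card_neighborFinset_eq_degree, ← gdeg_eq_degree] at this
    omega
  obtain ⟨S, hS, hSc⟩ := Finset.exists_subset_card_eq hcard
  have hch : ∀ x ∈ S, T.Adj u x ∧ T.dist v x = T.dist v u + 1 := by
    intro x hx
    have := hS hx
    rw [Finset.mem_erase, SimpleGraph.mem_neighborFinset] at this
    refine ⟨this.2, ?_⟩
    rcases hP.2.2.2.1 u x this.2 with h1 | h1
    · exact h1
    · exact absurd (hP.2.2.1 x u this.2.symm h1).symm this.1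
  have hu0 : T.dist v u ≠ 0 := fun h0 => hne (hP.2.2.2.2 u h0)
  have hr : (av T S).Reachable u v := by
    have := hP.chain S u (T.dist v u) (by
      intro j _ hm
      have h1 := (hch _ hm).2
      rw [hP.depth_iter] at h1
      omega)
    rwa [hP.iter_root] at this
  have := shift hE hne S (Finset.card_pos.1 (by omega)) (fun x hx => (hch x hx).1)
    (by
      intro x hx hadj
      have h1 := (hch x hx).2
      rcases hP.2.2.2.1 v x hadj with h2 | h2 <;> rw [SimpleGraph.dist_self] at h2 <;> omega)
    (by
      intro hm
      have h1 := (hch v hm).2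
      rw [SimpleGraph.dist_self] at h1; omega)
    (by omega) hr
  linarith

/-- ancestors have larger values -/
lemma anc_mono {V : Type*} [Fintype V] [DecidableEq V] {T : SimpleGraph V} {lam : ℝ} {h : V → ℝ}
    (hE : Extr T lam h) {r : V} {par : V → V} (hP : IsPar T r par) (hmax : ∀ v, h v ≤ h r) :
    ∀ (n : ℕ) (a d : V) (k : ℕ), T.dist r a = n → par^[k] d = a → h d ≤ h a := by
  classical
  intro n
  induction n with
  | zero =>
    intro a d k ha _
    rw [hP.2.2.2.2 a ha]; exact hmax d
  | succ n ih =>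
    intro a d k ha hk
    by_contra hcon
    push Not at hcon
    have har : a ≠ r := by rintro rfl; rw [SimpleGraph.dist_self] at ha; omega
    obtain ⟨hap, hapd⟩ := hP.2.1 a har
    have hk0 : k ≠ 0 := by
      rintro rfl
      rw [Function.iterate_zero, id] at hk
      rw [hk] at hcon; exact lt_irrefl _ hcon
    obtain ⟨m, rfl⟩ := Nat.exists_eq_succ_of_ne_zero hk0
    have hdd : T.dist r a = T.dist r d - (m + 1) := by rw [← hk]; exact hP.depth_iter d (m + 1)
    -- child of a on the chain
    have hc := hk
    rw [Function.iterate_succ_apply'] at hc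
    have hcd := hP.depth_iter d m
    have hcr : par^[m] d ≠ r := by
      intro h0; rw [h0, hP.1] at hc; exact har hc.symm
    have hcadj := (hP.2.1 _ hcr).1
    rw [hc] at hcadj
    have h2 : 2 ≤ gdeg T a := by
      have hsub : ({par a, par^[m] d} : Set V) ⊆ T.neighborSet a := by
        rintro x (rfl | rfl)
        · exact hap
        · exact hcadj.symm
      have hne : par a ≠ par^[m] d := by
        intro h0; rw [← h0] at hcd; omega
      rw [← Set.ncard_pair hne]
      exact Set.ncard_le_ncard hsub
    have h3 : 2 ≤ gdeg T d := h2.trans (deg_mono hE hcon.le)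
    obtain ⟨e, hde, hep⟩ : ∃ e, T.Adj d e ∧ e ≠ par d := by
      obtain ⟨e, he, hne⟩ := Set.exists_ne_of_one_lt_ncard (s := T.neighborSet d) h3 (par d)
      exact ⟨e, he, hne⟩
    have hed : T.dist r e = T.dist r d + 1 := by
      rcases hP.2.2.2.1 d e hde with h1 | h1
      · exact h1
      · exact absurd (hP.2.2.1 e d hde.symm h1).symm hep
    have hpe : par e = d := hP.2.2.1 d e hde hed
    have h4 : h e ≤ h (par a) := by
      refine ih (par a) e (m + 3) (by omega) ?_
      rw [Function.iterate_succ_apply, hpe, Function.iterate_succ_apply', hk]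
    have hr : (av T {par a, e}).Reachable d a := by
      rw [← hk]
      refine hP.chain _ d (m + 1) ?_
      intro j hj hm
      have hj' := hP.depth_iter d j
      rw [hk] at hm
      rw [Finset.mem_insert, Finset.mem_singleton] at hm
      rcases hm with hm | hm <;> rw [hm] at hj' <;> omega
    have := (switch hE (w₁ := a) (w₂ := d) (v₁ := par a) (v₂ := e)
      (by rintro rfl; omega) (by intro h0; rw [← h0] at hed; omega) hap hde
      (by intro h0; rcases hP.2.2.2.1 _ _ h0 with h1 | h1 <;> omega)
      (by intro h0; rcases hP.2.2.2.1 _ _ h0 with h1 | h1 <;> omega)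
      (by intro h0; rw [← h0] at hed; omega)
      (by intro h0; rw [← h0] at hapd; omega)
      hr.symm).1 hcon
    linarith

/-- children comparison -/
lemma child_cmp {V : Type*} [Fintype V] [DecidableEq V] {T : SimpleGraph V} {lam : ℝ} {h : V → ℝ}
    (hE : Extr T lam h) {r : V} {par : V → V} (hP : IsPar T r par)
    {w₁ w₂ v₁ v₂ : V} (hw : w₁ ≠ w₂) (h11 : T.Adj w₁ v₁) (d1 : T.dist r v₁ = T.dist r w₁ + 1)
    (h22 : T.Adj w₂ v₂) (d2 : T.dist r v₂ = T.dist r w₂ + 1)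
    (n1 : ∀ k, par^[k] w₂ ≠ v₁) (n2 : ∀ k, par^[k] w₁ ≠ v₂) :
    (h w₁ < h w₂ → h v₁ < h v₂) ∧ (h w₁ = h w₂ → h v₁ = h v₂) := by
  have p1 := hP.2.2.1 _ _ h11 d1
  have p2 := hP.2.2.1 _ _ h22 d2
  have r1 : (av T {v₁, v₂}).Reachable w₁ r := by
    have := hP.chain {v₁, v₂} w₁ (T.dist r w₁) (by
      intro j _ hm
      rw [Finset.mem_insert, Finset.mem_singleton] at hm
      rcases hm with hm | hm
      · have := hP.depth_iter w₁ j
        rw [hm] at this; omega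
      · exact n2 j hm)
    rwa [hP.iter_root] at this
  have r2 : (av T {v₁, v₂}).Reachable w₂ r := by
    have := hP.chain {v₁, v₂} w₂ (T.dist r w₂) (by
      intro j _ hm
      rw [Finset.mem_insert, Finset.mem_singleton] at hm
      rcases hm with hm | hm
      · exact n1 j hm
      · have := hP.depth_iter w₂ j
        rw [hm] at this; omega)
    rwa [hP.iter_root] at this
  refine switch hE hw ?_ h11 h22 ?_ ?_ ?_ ?_ (r1.trans r2.symm)
  · intro h0; rw [h0, p2] at p1; exact hw p1.symm
  · intro h0
    rcases hP.2.2.2.1 _ _ h0 with h1 | h1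
    · exact hw ((hP.2.2.1 _ _ h0 h1).symm.trans p2)
    · exact n2 1 (hP.2.2.1 _ _ h0.symm h1)
  · intro h0
    rcases hP.2.2.2.1 _ _ h0 with h1 | h1
    · exact hw (p1.symm.trans (hP.2.2.1 _ _ h0 h1))
    · exact n1 1 (hP.2.2.1 _ _ h0.symm h1)
  · exact n2 0
  · exact n1 0

/-- tie-breaking relation -/
def tb {V : Type*} (i : V → ℕ) (par : V → V) : ℕ → V → V → Prop
  | 0, u, v => i u < i v
  | n + 1, u, v => tb i par n (par u) (par v) ∨ (par u = par v ∧ i u < i v)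

lemma tb_irrefl {V : Type*} (i : V → ℕ) (par : V → V) (n : ℕ) : ∀ u, ¬ tb i par n u u := by
  induction n with
  | zero => intro u; simp [tb]
  | succ n ih => intro u; simp [tb, ih]

lemma tb_trans {V : Type*} (i : V → ℕ) (par : V → V) (n : ℕ) :
    ∀ u v w, tb i par n u v → tb i par n v w → tb i par n u w := by
  induction n with
  | zero => intro u v w h1 h2; simp only [tb] at *; omega
  | succ n ih =>
    intro u v w h1 h2
    simp only [tb] at *
    rcases h1 with h1 | ⟨h1, h1'⟩ <;> rcases h2 with h2 | ⟨h2, h2'⟩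
    · exact Or.inl (ih _ _ _ h1 h2)
    · rw [h2] at h1; exact Or.inl h1
    · rw [← h1] at h2; exact Or.inl h2
    · exact Or.inr ⟨h1.trans h2, h1'.trans h2'⟩

lemma tb_tri {V : Type*} (i : V → ℕ) (hi : Function.Injective i) (par : V → V) (n : ℕ) :
    ∀ u v, tb i par n u v ∨ u = v ∨ tb i par n v u := by
  induction n with
  | zero =>
    intro u v; simp only [tb]
    rcases lt_trichotomy (i u) (i v) with h | h | h
    · exact Or.inl h
    · exact Or.inr (Or.inl (hi h))
    · exact Or.inr (Or.inr h)
  | succ n ih =>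
    intro u v
    simp only [tb]
    rcases ih (par u) (par v) with h | h | h
    · exact Or.inl (Or.inl h)
    · rcases lt_trichotomy (i u) (i v) with h' | h' | h'
      · exact Or.inl (Or.inr ⟨h, h'⟩)
      · exact Or.inr (Or.inl (hi h'))
      · exact Or.inr (Or.inr (Or.inr ⟨h.symm, h'⟩))
    · exact Or.inr (Or.inr (Or.inl h))

/-- the order -/
def ord {V : Type*} (h : V → ℝ) (δ : V → ℕ) (i : V → ℕ) (par : V → V) (u v : V) : Prop :=
  h v < h u ∨ (h u = h v ∧ (δ u < δ v ∨ (δ u = δ v ∧ tb i par (δ u) u v)))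

lemma ord_sto {V : Type*} (h : V → ℝ) (δ : V → ℕ) (i : V → ℕ) (hi : Function.Injective i)
    (par : V → V) : IsStrictTotalOrder V (ord h δ i par) where
  irrefl u := by simp [ord, tb_irrefl]
  trans u v w h1 h2 := by
    rcases h1 with h1 | ⟨h1, h1' | ⟨h1', h1''⟩⟩ <;> rcases h2 with h2 | ⟨h2, h2' | ⟨h2', h2''⟩⟩
    · exact Or.inl (h2.trans h1)
    · exact Or.inl (h2 ▸ h1)
    · exact Or.inl (h2 ▸ h1)
    · exact Or.inl (h1.symm ▸ h2)
    · exact Or.inr ⟨h1.trans h2, Or.inl (h1'.trans h2')⟩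
    · exact Or.inr ⟨h1.trans h2, Or.inl (h2' ▸ h1')⟩
    · exact Or.inl (h1.symm ▸ h2)
    · exact Or.inr ⟨h1.trans h2, Or.inl (h1'.symm ▸ h2')⟩
    · refine Or.inr ⟨h1.trans h2, Or.inr ⟨h1'.trans h2', ?_⟩⟩
      rw [← h1'] at h2''
      exact tb_trans _ _ _ _ _ _ h1'' h2''
  trichotomous u v h1 h2 := by
    by_contra hne
    rcases lt_trichotomy (h u) (h v) with h3 | h3 | h3
    · exact h2 (Or.inl h3)
    · rcases lt_trichotomy (δ u) (δ v) with h4 | h4 | h4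
      · exact h1 (Or.inr ⟨h3, Or.inl h4⟩)
      · rcases tb_tri i hi par (δ u) u v with h5 | h5 | h5
        · exact h1 (Or.inr ⟨h3, Or.inr ⟨h4, h5⟩⟩)
        · exact hne h5
        · exact h2 (Or.inr ⟨h3.symm, Or.inr ⟨h4.symm, h4 ▸ h5⟩⟩)
      · exact h2 (Or.inr ⟨h3.symm, Or.inl h4⟩)
    · exact h1 (Or.inl h3)

lemma main {V : Type*} [Fintype V] [DecidableEq V] {T : SimpleGraph V} {lam : ℝ} {h : V → ℝ}
    (hE : Extr T lam h) : ∃ (v₀ : V) (lt : V → V → Prop), IsBFDOrdering T v₀ lt ∧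
      ∀ u v : V, h v < h u → lt u v := by
  have : Nonempty V := hE.1.connected.nonempty
  obtain ⟨r, hmax⟩ := Finite.exists_max h
  obtain ⟨par, hP⟩ := exists_par T hE.1 r
  let i : V → ℕ := fun v => (Fintype.equivFin V v : ℕ)
  have hi : Function.Injective i := fun u v huv =>
    (Fintype.equivFin V).injective (Fin.ext huv)
  refine ⟨r, ord h (fun v => T.dist r v) i par, ⟨ord_sto _ _ i hi par, ?_, ?_, ?_⟩, ?_⟩
  · intro v hv
    rcases (hmax v).lt_or_eq with h1 | h1
    · exact Or.inl h1
    · refine Or.inr ⟨h1.symm, Or.inl ?_⟩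
      dsimp only
      rw [SimpleGraph.dist_self]
      exact Nat.pos_of_ne_zero fun h0 => hv (hP.2.2.2.2 v h0)
  · intro w₁ w₂ v₁ v₂ hlt h11 d1 h22 d2
    have p1 := hP.2.2.1 _ _ h11 d1
    have p2 := hP.2.2.1 _ _ h22 d2
    have hle : h w₂ ≤ h w₁ := by
      rcases hlt with h1 | ⟨h1, -⟩
      · exact h1.le
      · exact h1.symm.le
    have hw : w₁ ≠ w₂ := by
      rintro rfl
      exact (ord_sto h (fun v => T.dist r v) i hi par).irrefl _ hlt
    have hv2 : h v₂ ≤ h w₂ := anc_mono hE hP hmax _ w₂ v₂ 1 rfl p2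
    by_cases n1 : ∃ k, par^[k] w₂ = v₁
    · obtain ⟨k, hk⟩ := n1
      have h3 : h w₂ ≤ h v₁ := anc_mono hE hP hmax _ v₁ w₂ k rfl hk
      rcases (hv2.trans h3).lt_or_eq with h4 | h4
      · exact Or.inl h4
      · refine Or.inr ⟨h4.symm, Or.inl ?_⟩
        have := hP.depth_iter w₂ k
        rw [hk] at this
        dsimp only
        omega
    push Not at n1
    by_cases n2 : ∃ k, par^[k] w₁ = v₂
    · exfalso
      obtain ⟨k, hk⟩ := n2
      have h3 : h w₁ ≤ h v₂ := anc_mono hE hP hmax _ v₂ w₁ k rfl hk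
      have h4 := hP.depth_iter w₁ k
      rw [hk] at h4
      rcases hlt with h1 | ⟨-, h1 | ⟨h1, -⟩⟩
      · linarith
      · dsimp only at h1; omega
      · dsimp only at h1; omega
    push Not at n2
    rcases hlt with h1 | ⟨h1, h2⟩
    · exact Or.inl ((child_cmp hE hP hw.symm h22 d2 h11 d1 n2 n1).1 h1)
    · refine Or.inr ⟨(child_cmp hE hP hw h11 d1 h22 d2 n1 n2).2 h1, ?_⟩
      dsimp only at h2 ⊢
      rcases h2 with h2 | ⟨h2, h3⟩
      · left; omega
      · right
        refine ⟨by omega, ?_⟩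
        rw [d1]
        exact Or.inl (by rw [p1, p2]; exact h3)
  · intro v u hlt
    refine deg_mono hE ?_
    rcases hlt with h1 | ⟨h1, -⟩
    · exact h1.le
    · exact h1.symm.le
  · intro u v huv
    exact Or.inl huv

end BFD

/-- If `T` is extremal in `𝒯_π` with eigenvector `f` for `λ(T)`, then `T` admits
a BFD-ordering `≺` consistent with `f`: `|f u| > |f v|` implies `u ≺ v`. -/
theorem stmt12 {V : Type*} [Fintype V] [DecidableEq V] (T : SimpleGraph V)
    (hT : T.IsTree) (lam : ℝ) (hlam : IsMaxEig T lam)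
    (hext : ∀ T'' : SimpleGraph V, T''.IsTree →
      (∃ σ : Equiv.Perm V, ∀ w, gdeg T'' (σ w) = gdeg T w) →
      ∀ lam'' : ℝ, IsMaxEig T'' lam'' → lam'' ≤ lam)
    (f : V → ℝ) (hf : f ≠ 0) (hef : (lap T).mulVec f = lam • f) :
    ∃ (v₀ : V) (lt : V → V → Prop), IsBFDOrdering T v₀ lt ∧
      ∀ u v : V, |f v| < |f u| → lt u v := by
  exact BFD.main (BFD.extr_of T hT lam hext f hf hef)
end
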